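/- arXiv:math/0703643 — 3 statements merged into one kernel-verified Lean document; each statement's English description precedes it below -/
import Mathlib

section
/- Let R be a commutative ring, C a semidualizing R-module, M an R-module, and n a nonnegative integer. Then M admits an augmented proper P_C-projective resolution X⁺ with X_i = 0 for all i > n if and only if there exists an exact sequence 0 → C ⊗_R P_n → ⋯ → C ⊗_R P_1 → C ⊗_R P_0 → M → 0 with each P_i a projective R-module; moreover, any such exact sequence is itself an augmented proper P_C-projective resolution of M. -/
open TensorProduct CategoryTheory

noncomputable section

/-- The natural evaluation map `ν_M : C ⊗_R Hom_R(C,M) → M`, `c ⊗ f ↦ f c`. -/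
def evalNu (R : Type) [CommRing R] (C : Type) [AddCommGroup C] [Module R C]
    (M : Type) [AddCommGroup M] [Module R M] :
    (C ⊗[R] (C →ₗ[R] M)) →ₗ[R] M :=
  TensorProduct.lift LinearMap.applyₗ

/-- The natural map `μ_M : M → Hom_R(C, C ⊗_R M)`, `m ↦ (c ↦ c ⊗ m)`. -/
def muMap (R : Type) [CommRing R] (C : Type) [AddCommGroup C] [Module R C]
    (M : Type) [AddCommGroup M] [Module R M] :
    M →ₗ[R] (C →ₗ[R] (C ⊗[R] M)) :=
  (TensorProduct.mk R C M).flip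

/-- `Ext^i_R(A,B)`. -/
def extMod (R : Type) [CommRing R] (A : Type) [AddCommGroup A] [Module R A]
    (B : Type) [AddCommGroup B] [Module R B] (i : ℕ) : ModuleCat R :=
  ((Ext R (ModuleCat R) i).obj (Opposite.op (ModuleCat.of R A))).obj (ModuleCat.of R B)

/-- `Tor_i^R(A,B)`. -/
def torMod (R : Type) [CommRing R] (A : Type) [AddCommGroup A] [Module R A]
    (B : Type) [AddCommGroup B] [Module R B] (i : ℕ) : ModuleCat R :=
  ((Tor (ModuleCat R) i).obj (ModuleCat.of R A)).obj (ModuleCat.of R B)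

/-- A semidualizing module: `C` admits a degreewise finite projective resolution,
the homothety map `R → Hom_R(C,C)` is bijective, and `Ext^i_R(C,C) = 0` for `i ≥ 1`. -/
def IsSemidualizing (R : Type) [CommRing R] (C : Type) [AddCommGroup C] [Module R C] :
    Prop :=
  (∃ (P : ℕ → ModuleCat.{0} R) (d : ∀ n, ↥(P (n + 1)) →ₗ[R] ↥(P n)) (ε : ↥(P 0) →ₗ[R] C),
      (∀ n, Module.Finite R ↥(P n)) ∧ (∀ n, Module.Projective R ↥(P n)) ∧
      Function.Surjective ε ∧ Function.Exact (d 0) ε ∧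
      ∀ n, Function.Exact (d (n + 1)) (d n)) ∧
  Function.Bijective (fun r : R => (r • LinearMap.id : C →ₗ[R] C)) ∧
  ∀ i : ℕ, 1 ≤ i → Subsingleton (extMod R C C i)

/-- The Bass class `B_C`. -/
def MemBassClass (R : Type) [CommRing R] (C : Type) [AddCommGroup C] [Module R C]
    (M : Type) [AddCommGroup M] [Module R M] : Prop :=
  (∀ i : ℕ, 1 ≤ i → Subsingleton (extMod R C M i)) ∧
  (∀ i : ℕ, 1 ≤ i → Subsingleton (torMod R C (C →ₗ[R] M) i)) ∧
  Function.Bijective (evalNu R C M)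

/-- The Auslander class `A_C`. -/
def MemAuslanderClass (R : Type) [CommRing R] (C : Type) [AddCommGroup C] [Module R C]
    (M : Type) [AddCommGroup M] [Module R M] : Prop :=
  (∀ i : ℕ, 1 ≤ i → Subsingleton (torMod R C M i)) ∧
  (∀ i : ℕ, 1 ≤ i → Subsingleton (extMod R C (C ⊗[R] M) i)) ∧
  Function.Bijective (muMap R C M)

/-- `X⁺ : ⋯ → C ⊗ P₁ → C ⊗ P₀ → M → 0` is an augmented proper `P_C`-projective resolution:
each `Pᵢ` is projective, it is a complex, and `Hom_R(C ⊗ Q, X⁺)` is exact for each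
projective module `Q`. -/
def IsAugProperRes (R : Type) [CommRing R] (C : Type) [AddCommGroup C] [Module R C]
    (M : Type) [AddCommGroup M] [Module R M] (P : ℕ → ModuleCat.{0} R)
    (d : ∀ n : ℕ, (C ⊗[R] ↥(P (n + 1))) →ₗ[R] (C ⊗[R] ↥(P n)))
    (ε : (C ⊗[R] ↥(P 0)) →ₗ[R] M) : Prop :=
  (∀ n, Module.Projective R ↥(P n)) ∧
  (∀ n, (d n).comp (d (n + 1)) = 0) ∧ (ε.comp (d 0) = 0) ∧
  ∀ (Q : Type) [AddCommGroup Q] [Module R Q], Module.Projective R Q →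
    Function.Surjective (fun g : (C ⊗[R] Q) →ₗ[R] (C ⊗[R] ↥(P 0)) => ε.comp g) ∧
    Function.Exact (fun g : (C ⊗[R] Q) →ₗ[R] (C ⊗[R] ↥(P 1)) => (d 0).comp g)
      (fun g : (C ⊗[R] Q) →ₗ[R] (C ⊗[R] ↥(P 0)) => ε.comp g) ∧
    ∀ n : ℕ, Function.Exact
      (fun g : (C ⊗[R] Q) →ₗ[R] (C ⊗[R] ↥(P (n + 2))) => (d (n + 1)).comp g)
      (fun g : (C ⊗[R] Q) →ₗ[R] (C ⊗[R] ↥(P (n + 1))) => (d n).comp g)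

/-- Exactness of the augmented complex `⋯ → C ⊗ P₁ → C ⊗ P₀ → M → 0`. -/
def ResExact (R : Type) [CommRing R] (C : Type) [AddCommGroup C] [Module R C]
    (M : Type) [AddCommGroup M] [Module R M] (P : ℕ → ModuleCat.{0} R)
    (d : ∀ n : ℕ, (C ⊗[R] ↥(P (n + 1))) →ₗ[R] (C ⊗[R] ↥(P n)))
    (ε : (C ⊗[R] ↥(P 0)) →ₗ[R] M) : Prop :=
  Function.Surjective ε ∧ Function.Exact (d 0) ε ∧
    ∀ n : ℕ, Function.Exact (d (n + 1)) (d n)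

/-- Exactness of the augmented complex in all degrees `< n`
(`C ⊗ Pᵢ` in degree `i`, `M` in degree `-1`). -/
def ResExactLT (R : Type) [CommRing R] (C : Type) [AddCommGroup C] [Module R C]
    (M : Type) [AddCommGroup M] [Module R M] (P : ℕ → ModuleCat.{0} R)
    (d : ∀ n : ℕ, (C ⊗[R] ↥(P (n + 1))) →ₗ[R] (C ⊗[R] ↥(P n)))
    (ε : (C ⊗[R] ↥(P 0)) →ₗ[R] M) (n : ℕ) : Prop :=
  Function.Surjective ε ∧ (0 < n → Function.Exact (d 0) ε) ∧
    ∀ i : ℕ, i + 1 < n → Function.Exact (d (i + 1)) (d i)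


/-- An exact sequence `0 → C ⊗ P_n → ⋯ → C ⊗ P_1 → C ⊗ P_0 → M → 0`
with each `P_i` projective (encoded by an `ℕ`-indexed complex which vanishes
in degrees `> n`). -/
def HasBoundedExactCRes (R : Type) [CommRing R] (C : Type) [AddCommGroup C] [Module R C]
    (M : Type) [AddCommGroup M] [Module R M] (n : ℕ) : Prop :=
  ∃ (P : ℕ → ModuleCat.{0} R)
    (d : ∀ i : ℕ, (C ⊗[R] ↥(P (i + 1))) →ₗ[R] (C ⊗[R] ↥(P i)))
    (ε : (C ⊗[R] ↥(P 0)) →ₗ[R] M),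
      (∀ i, Module.Projective R ↥(P i)) ∧ ResExact R C M P d ε ∧
      ∀ i, n < i → Subsingleton (C ⊗[R] ↥(P i))

/-- `M` has finite `P_C`-projective dimension. -/
def HasFinCPd (R : Type) [CommRing R] (C : Type) [AddCommGroup C] [Module R C]
    (M : Type) [AddCommGroup M] [Module R M] : Prop :=
  ∃ n : ℕ, HasBoundedExactCRes R C M n

/-- `M` has projective dimension at most `n`: there is an exact sequence
`0 → Q_n → ⋯ → Q_0 → M → 0` with each `Q_i` projective. -/
def HasProjDimLE (R : Type) [CommRing R] (M : Type) [AddCommGroup M] [Module R M]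
    (n : ℕ) : Prop :=
  ∃ (Q : ℕ → ModuleCat.{0} R) (d : ∀ i : ℕ, ↥(Q (i + 1)) →ₗ[R] ↥(Q i))
    (ε : ↥(Q 0) →ₗ[R] M),
      (∀ i, Module.Projective R ↥(Q i)) ∧ Function.Surjective ε ∧
      Function.Exact (d 0) ε ∧ (∀ i, Function.Exact (d (i + 1)) (d i)) ∧
      ∀ i, n < i → Subsingleton ↥(Q i)

/-- `M` has injective dimension at most `n`: there is an exact sequence
`0 → M → I⁰ → ⋯ → Iⁿ → 0` with each `I^j` injective. -/
def HasInjDimLE (R : Type) [CommRing R] (M : Type) [AddCommGroup M] [Module R M]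
    (n : ℕ) : Prop :=
  ∃ (I : ℕ → ModuleCat.{0} R) (δ : ∀ j : ℕ, ↥(I j) →ₗ[R] ↥(I (j + 1)))
    (ι : M →ₗ[R] ↥(I 0)),
      (∀ j, Module.Injective R ↥(I j)) ∧ Function.Injective ι ∧
      Function.Exact ι (δ 0) ∧ (∀ j, Function.Exact (δ j) (δ (j + 1))) ∧
      ∀ j, n < j → Subsingleton ↥(I j)

section
variable {R : Type} [CommRing R] {C : Type} [AddCommGroup C] [Module R C]
  (F : ℕ → ModuleCat.{0} R) (d : ∀ n, ↥(F (n + 1)) →ₗ[R] ↥(F n)) (ε : ↥(F 0) →ₗ[R] C)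

/-- the complex of a resolution -/
def resCx (hd : ∀ n, Function.Exact (d (n + 1)) (d n)) : ChainComplex (ModuleCat.{0} R) ℕ :=
  ChainComplex.of F (fun n => ModuleCat.ofHom (d n)) (fun n => by
    ext x; exact (hd n).apply_apply_eq_zero x)

lemma resCx_d (hd : ∀ n, Function.Exact (d (n + 1)) (d n)) (n : ℕ) :
    (resCx F d hd).d (n + 1) n = ModuleCat.ofHom (d n) :=
  ChainComplex.of_d F (fun n => ModuleCat.ofHom (d n)) n

lemma resCx_exactAt (hd : ∀ n, Function.Exact (d (n + 1)) (d n)) (n : ℕ) :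
    (resCx F d hd).ExactAt (n + 1) := by
  rw [HomologicalComplex.exactAt_iff' _ (n + 1 + 1) (n + 1) n (by simp) (by simp)]
  rw [ShortComplex.moduleCat_exact_iff]
  intro x hx
  change (resCx F d hd).d (n + 1) n x = 0 at hx
  rw [resCx_d] at hx
  obtain ⟨y, hy⟩ := (hd n x).1 hx
  refine ⟨y, ?_⟩
  change (resCx F d hd).d (n + 1 + 1) (n+1) y = x
  rw [resCx_d]
  exact hy

/-- the augmentation, as a morphism in degree zero -/
def resEps (hd : ∀ n, Function.Exact (d (n + 1)) (d n)) :
    (resCx F d hd).X 0 ⟶ ModuleCat.of R C := ModuleCat.ofHom ε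

/-- the augmentation, as a morphism of complexes -/
def resPi (h0 : Function.Exact (d 0) ε) (hd : ∀ n, Function.Exact (d (n + 1)) (d n)) :
    resCx F d hd ⟶ (ChainComplex.single₀ _).obj (ModuleCat.of R C) :=
  (ChainComplex.toSingle₀Equiv _ _).symm ⟨resEps F d ε hd, by
    change (resCx F d hd).d (0 + 1) 0 ≫ _ = 0
    rw [resCx_d]; ext x; exact h0.apply_apply_eq_zero x⟩

lemma resPi_f (h0 : Function.Exact (d 0) ε) (hd : ∀ n, Function.Exact (d (n + 1)) (d n)) :
    (resPi F d ε h0 hd).f 0 = resEps F d ε hd :=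
  ChainComplex.toSingle₀Equiv_symm_apply_f_zero _ _

/-- the projective resolution -/
def projRes (hp : ∀ n, Module.Projective R ↥(F n))
    (hε : Function.Surjective ε) (h0 : Function.Exact (d 0) ε)
    (hd : ∀ n, Function.Exact (d (n + 1)) (d n)) :
    ProjectiveResolution (ModuleCat.of R C) where
  complex := resCx F d hd
  projective n := by
    have := hp n
    exact (IsProjective.iff_projective (F n)).1 this
  π := resPi F d ε h0 hd
  quasiIso := ⟨fun n => by
    cases n
    · rw [ChainComplex.quasiIsoAt₀_iff, ShortComplex.quasiIso_iff_of_zeros' _ rfl rfl rfl]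
      constructor
      · rw [ShortComplex.moduleCat_exact_iff]
        intro x hx
        change (resPi F d ε h0 hd).f 0 x = 0 at hx
        rw [resPi_f] at hx
        obtain ⟨y, hy⟩ := (h0 x).1 hx
        refine ⟨y, ?_⟩
        change (resCx F d hd).d (0 + 1) 0 y = x
        rw [resCx_d]
        exact hy
      · change Epi ((resPi F d ε h0 hd).f 0)
        rw [resPi_f]
        exact (ModuleCat.epi_iff_surjective _).2 hε
    · rw [quasiIsoAt_iff_exactAt']
      · apply resCx_exactAt
      · apply ChainComplex.exactAt_succ_single_obj⟩

lemma ext_elem (hp : ∀ n, Module.Projective R ↥(F n))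
    (hε : Function.Surjective ε) (h0 : Function.Exact (d 0) ε)
    (hd : ∀ n, Function.Exact (d (n + 1)) (d n))
    (B : Type) [AddCommGroup B] [Module R B] (n : ℕ) (hE : Subsingleton (extMod R C B (n+1)))
    (f : F (n+1) →ₗ[R] B) (hf : f ∘ₗ d (n+1) = 0) : ∃ g : F n →ₗ[R] B, g ∘ₗ d n = f := by
  have hz : Limits.IsZero (extMod R C B (n+1)) := ModuleCat.isZero_of_subsingleton _
  have hz' := Limits.IsZero.of_iso hz
    ((projRes F d ε hp hε h0 hd).isoExt (R := R) (n+1) (ModuleCat.of R B)).symm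
  rw [← HomologicalComplex.exactAt_iff_isZero_homology,
    HomologicalComplex.exactAt_iff' _ n (n + 1) (n + 1 + 1) (by simp) (by simp),
    ShortComplex.moduleCat_exact_iff] at hz'
  obtain ⟨g, hg⟩ := hz' (ModuleCat.ofHom f) (by
    change (resCx F d hd).d (n + 1 + 1) (n+1) ≫ (ModuleCat.ofHom f) = 0
    rw [resCx_d]
    ext x; exact LinearMap.congr_fun hf x)
  change (resCx F d hd).d (n + 1) n ≫ g = ModuleCat.ofHom f at hg
  rw [resCx_d] at hg
  refine ⟨ModuleCat.Hom.hom g, ?_⟩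
  ext x
  exact congrArg (fun k => ModuleCat.Hom.hom k x) hg
end

section
variable {R : Type} [CommRing R]

lemma exists_nonzero_killed {A K : Type} [CommRing A] [AddCommGroup K] [Module A K]
    (x : K) (hx : x ≠ 0) (S : Finset A) (h : ∀ a ∈ S, ∃ k : ℕ, a ^ k • x = 0) :
    ∃ r : A, r • x ≠ 0 ∧ ∀ a ∈ S, a • r • x = 0 := by
  classical
  induction S using Finset.induction_on with
  | empty => exact ⟨1, by simpa using hx, by simp⟩
  | insert a S ha ih =>
    obtain ⟨r, hr, hS⟩ := ih (fun b hb => h b (Finset.mem_insert_of_mem hb))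
    obtain ⟨k, hk⟩ := h a (Finset.mem_insert_self a S)
    have hex : ∃ k : ℕ, a ^ k • r • x = 0 := ⟨k, by rw [smul_comm, hk, smul_zero]⟩
    have h1 := Nat.find_spec hex
    have h2 := fun m => Nat.find_min hex (m := m)
    rcases hm : Nat.find hex with _ | j
    · rw [hm, pow_zero, one_smul] at h1
      exact absurd h1 hr
    · rw [hm] at h1 h2
      refine ⟨a ^ j * r, ?_, ?_⟩
      · rw [mul_smul]
        exact h2 j (Nat.lt_succ_self j)
      · intro b hb
        rcases Finset.mem_insert.1 hb with rfl | hb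
        · rw [smul_smul, ← mul_assoc, ← pow_succ', mul_smul]
          exact h1
        · rw [mul_smul, smul_comm, hS b hb, smul_zero]

lemma factor_of_exact {F0 F1 C D : Type} [AddCommGroup F0] [Module R F0] [AddCommGroup F1]
    [Module R F1] [AddCommGroup C] [Module R C] [AddCommGroup D] [Module R D]
    (d : F1 →ₗ[R] F0) (ε : F0 →ₗ[R] C) (hε : Function.Surjective ε)
    (h0 : Function.Exact d ε) (θ : F0 →ₗ[R] D) (hθ : θ ∘ₗ d = 0) :
    ∃ h : C →ₗ[R] D, h ∘ₗ ε = θ := by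
  have hk : LinearMap.ker ε ≤ LinearMap.ker θ := by
    intro z hz
    obtain ⟨y, rfl⟩ := (h0 z).1 hz
    exact LinearMap.congr_fun hθ y
  refine ⟨(LinearMap.ker ε).liftQ θ hk ∘ₗ
    (ε.quotKerEquivOfSurjective hε).symm.toLinearMap, ?_⟩
  ext z
  have : (ε.quotKerEquivOfSurjective hε).symm (ε z) = (LinearMap.ker ε).mkQ z := by
    rw [LinearEquiv.symm_apply_eq]
    rfl
  simp only [LinearMap.comp_apply, LinearEquiv.coe_coe]
  rw [this]
  simp

lemma projLift {F B D : Type} [AddCommGroup F] [Module R F] [Module.Projective R F]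
    [AddCommGroup B] [Module R B] [AddCommGroup D] [Module R D]
    (g : B →ₗ[R] D) (h : F →ₗ[R] D) (hh : ∀ x, h x ∈ LinearMap.range g) :
    ∃ h' : F →ₗ[R] B, g ∘ₗ h' = h := by
  obtain ⟨k, hk⟩ := Module.projective_lifting_property g.rangeRestrict
    (h.codRestrict (LinearMap.range g) hh) g.surjective_rangeRestrict
  refine ⟨k, ?_⟩
  ext x
  exact congrArg Subtype.val (LinearMap.congr_fun hk x)

lemma eq_zero_of_hom {F0 F1 C K : Type} [AddCommGroup F0] [Module R F0] [AddCommGroup F1]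
    [Module R F1] [AddCommGroup C] [Module R C] [AddCommGroup K] [Module R K]
    [Module.Finite R F1] [Module.Finite R F0] [Module.Projective R F0]
    (d : F1 →ₗ[R] F0) (ε : F0 →ₗ[R] C) (hε : Function.Surjective ε)
    (h0 : Function.Exact d ε) (hann : Module.annihilator R C = ⊥)
    (hK : ∀ h : C →ₗ[R] K, h = 0) (x : K) : x = 0 := by
  classical
  by_contra hx
  have hfin : Module.Finite R C := Module.Finite.of_surjective ε hε
  have hfp : Module.FinitePresentation R C := by
    have := Module.finitePresentation_of_projective R F0
    refine Module.finitePresentation_of_surjective ε hε ?_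
    rw [h0.linearMap_ker_eq]
    exact Module.Finite.iff_fg.1 inferInstance
  let I : Ideal R := LinearMap.ker (LinearMap.toSpanSingleton R K x)
  have hI : I ≠ ⊤ := by
    intro h
    have : (1 : R) ∈ I := h ▸ Submodule.mem_top
    apply hx
    simpa [I] using this
  obtain ⟨p, hp⟩ := Ideal.nonempty_minimalPrimes hI
  have : p.IsPrime := hp.1.1
  let mk := LocalizedModule.mkLinearMap p.primeCompl K
  have hx' : mk x ≠ 0 := by
    intro h
    rw [IsLocalizedModule.eq_zero_iff p.primeCompl mk] at h
    obtain ⟨c, hc⟩ := h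
    have : (c : R) ∈ I := by
      have hc' : (c : R) • x = 0 := hc
      simpa [I] using hc'
    exact c.2 (hp.1.2 this)
  have hkill : I.map (algebraMap R (Localization.AtPrime p)) ≤
      LinearMap.ker (LinearMap.toSpanSingleton (Localization.AtPrime p) _ (mk x)) := by
    rw [Ideal.map_le_iff_le_comap]
    intro r hr
    have hr' : r • x = 0 := by simpa [I] using hr
    rw [Ideal.mem_comap, LinearMap.mem_ker, LinearMap.toSpanSingleton_apply, algebraMap_smul,
      ← map_smul, hr', map_zero]
  have hnil : ∀ a ∈ IsLocalRing.maximalIdeal (Localization.AtPrime p),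
      ∃ k : ℕ, a ^ k • mk x = 0 := by
    intro a ha
    rw [← IsLocalization.AtPrime.map_eq_maximalIdeal p (Localization.AtPrime p),
      ← IsLocalization.AtPrime.radical_map_of_mem_minimalPrimes (Localization.AtPrime p) p I hp] at ha
    obtain ⟨k, hk⟩ := ha
    exact ⟨k, by simpa using hkill hk⟩
  have hnt : Nontrivial (p.ResidueField ⊗[R] C) := by
    rw [← Module.mem_support_iff_nontrivial_residueField_tensorProduct ⟨p, inferInstance⟩,
      Module.support_eq_zeroLocus, hann]
    simp
  obtain ⟨v, hv⟩ := exists_ne (0 : p.ResidueField ⊗[R] C)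
  have : ∃ f : Module.Dual p.ResidueField (p.ResidueField ⊗[R] C), f v ≠ 0 := by
    by_contra! h
    exact hv ((Module.forall_dual_apply_eq_zero_iff p.ResidueField v).1 h)
  obtain ⟨f, hf⟩ := this
  let ψ : C →ₗ[R] p.ResidueField := f.restrictScalars R ∘ₗ TensorProduct.mk R p.ResidueField C 1
  have hψ : ∃ c, ψ c ≠ 0 := by
    by_contra! h
    apply hf
    induction v using TensorProduct.induction_on with
    | zero => simp
    | tmul a c =>
      have h1 : a ⊗ₜ[R] c = a • ((1 : p.ResidueField) ⊗ₜ[R] c) := by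
        rw [TensorProduct.smul_tmul', smul_eq_mul, mul_one]
      rw [h1, map_smul]
      have h2 : f ((1 : p.ResidueField) ⊗ₜ[R] c) = 0 := h c
      rw [h2, smul_zero]
    | add a b ha hb =>
      have key : ∀ w : p.ResidueField ⊗[R] C, f w = 0 := by
        intro w
        induction w using TensorProduct.induction_on with
        | zero => simp
        | tmul a c =>
          have h1 : a ⊗ₜ[R] c = a • ((1 : p.ResidueField) ⊗ₜ[R] c) := by
            rw [TensorProduct.smul_tmul', smul_eq_mul, mul_one]
          rw [h1, map_smul]
          have h2 : f ((1 : p.ResidueField) ⊗ₜ[R] c) = 0 := h c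
          rw [h2, smul_zero]
        | add a b ha hb => rw [map_add, ha, hb, add_zero]
      exact key _
  obtain ⟨c, hc⟩ := hψ
  obtain ⟨z, rfl⟩ := hε c
  let res : Localization.AtPrime p →ₗ[R] p.ResidueField :=
    (IsScalarTower.toAlgHom R (Localization.AtPrime p) p.ResidueField).toLinearMap
  have hres : Function.Surjective res := IsLocalRing.residue_surjective
  obtain ⟨φ, hφ⟩ := Module.projective_lifting_property res (ψ ∘ₗ ε) hres
  have hφz : IsUnit (φ z) := by
    have h1 : res (φ z) ≠ 0 := by
      have := LinearMap.congr_fun hφ z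
      simp only [LinearMap.comp_apply] at this
      rw [this]; exact hc
    by_contra h2
    exact h1 ((IsLocalRing.residue_eq_zero_iff (φ z)).2 ((IsLocalRing.mem_maximalIdeal _).2 h2))
  obtain ⟨T, hT⟩ := (Module.Finite.fg_top : (⊤ : Submodule R F1).FG)
  obtain ⟨r, hr, hS⟩ := exists_nonzero_killed (mk x) hx' (T.image (fun t => φ (d t))) (by
    intro a ha
    obtain ⟨t, _, rfl⟩ := Finset.mem_image.1 ha
    apply hnil
    rw [← IsLocalRing.residue_eq_zero_iff]
    have := LinearMap.congr_fun hφ (d t)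
    simp only [LinearMap.comp_apply, h0.apply_apply_eq_zero, map_zero] at this
    exact this)
  let θ := (LinearMap.toSpanSingleton (Localization.AtPrime p) _ (r • mk x)).restrictScalars R ∘ₗ φ
  obtain ⟨h, hh⟩ := factor_of_exact d ε hε h0 θ (by
    refine LinearMap.ext_on hT ?_
    intro t ht
    exact hS _ (Finset.mem_image_of_mem _ ht))
  obtain ⟨h', s, hs⟩ := Module.FinitePresentation.exists_lift_of_isLocalizedModule
    p.primeCompl mk h
  rw [hK h', LinearMap.comp_zero] at hs
  have h1 : s • h (ε z) = 0 := (LinearMap.congr_fun hs (ε z)).symm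
  have h2 : h (ε z) = 0 := by
    apply IsLocalizedModule.smul_injective mk s
    simpa using h1
  have h3 : φ z • r • mk x = 0 := by
    have := LinearMap.congr_fun hh z
    rw [LinearMap.comp_apply, h2] at this
    exact this.symm
  exact hr (hφz.smul_eq_zero.1 h3)

/-- Vanishing of the higher cohomology of `Hom(F, N)` for a submodule `N` of `B`. -/
def EN (F : ℕ → ModuleCat.{0} R) (d : ∀ n, ↥(F (n + 1)) →ₗ[R] ↥(F n))
    {B : Type} [AddCommGroup B] [Module R B] (N : Submodule R B) : Prop :=
  ∀ (n : ℕ) (h : F (n + 1) →ₗ[R] B), (∀ x, h x ∈ N) → h ∘ₗ d (n + 1) = 0 →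
    ∃ g : F n →ₗ[R] B, (∀ x, g x ∈ N) ∧ g ∘ₗ d n = h

variable {F : ℕ → ModuleCat.{0} R} {d : ∀ n, ↥(F (n + 1)) →ₗ[R] ↥(F n)}

lemma EN_subsingleton {B : Type} [AddCommGroup B] [Module R B] (N : Submodule R B)
    (hN : N = ⊥) : EN F d N := by
  subst hN
  intro n h hh _
  refine ⟨0, by simp, ?_⟩
  ext x
  have := hh x
  rw [Submodule.mem_bot] at this
  simp [this]

lemma EN_range (hp : ∀ n, Module.Projective R ↥(F n))
    (hd : ∀ n, Function.Exact (d (n + 1)) (d n))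
    {A B D : Type} [AddCommGroup A] [Module R A] [AddCommGroup B] [Module R B]
    [AddCommGroup D] [Module R D] (f : A →ₗ[R] B) (g : B →ₗ[R] D) (hfg : Function.Exact f g)
    (hA : EN F d (LinearMap.range f)) (hB : EN F d (⊤ : Submodule R B)) :
    EN F d (LinearMap.range g) := by
  intro n h hh hz
  have := hp (n + 1)
  obtain ⟨h', rfl⟩ := projLift g h hh
  obtain ⟨a, ha, ha'⟩ := hA (n + 1) (h' ∘ₗ d (n + 1))
    (fun x => (hfg _).1 (LinearMap.congr_fun hz x))
    (by ext x; simp [(hd (n + 1)).apply_apply_eq_zero])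
  obtain ⟨b, _, hb⟩ := hB n (h' - a) (fun _ => Submodule.mem_top)
    (by rw [LinearMap.sub_comp, ha', sub_self])
  refine ⟨g ∘ₗ b, fun x => ⟨b x, rfl⟩, ?_⟩
  rw [LinearMap.comp_assoc, hb, LinearMap.comp_sub]
  have : g ∘ₗ a = 0 := by
    ext x
    exact (hfg _).2 (ha x)
  rw [this, sub_zero]

lemma EN_lift (hp : ∀ n, Module.Projective R ↥(F n))
    (hd : ∀ n, Function.Exact (d (n + 1)) (d n))
    {C : Type} [AddCommGroup C] [Module R C] (ε : ↥(F 0) →ₗ[R] C)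
    (hε : Function.Surjective ε) (h0 : Function.Exact (d 0) ε)
    {A B D : Type} [AddCommGroup A] [Module R A] [AddCommGroup B] [Module R B]
    [AddCommGroup D] [Module R D] (f : A →ₗ[R] B) (g : B →ₗ[R] D) (hfg : Function.Exact f g)
    (hA : EN F d (LinearMap.range f)) (h : C →ₗ[R] D) (hh : ∀ x, h x ∈ LinearMap.range g) :
    ∃ h' : C →ₗ[R] B, g ∘ₗ h' = h := by
  have := hp 0
  obtain ⟨k, hk⟩ := projLift g (h ∘ₗ ε) (fun x => hh _)
  obtain ⟨a, ha, ha'⟩ := hA 0 (k ∘ₗ d 0)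
    (fun x => (hfg _).1 (by
      have := LinearMap.congr_fun hk (d 0 x)
      simpa [h0.apply_apply_eq_zero] using this))
    (by ext x; simp [(hd 0).apply_apply_eq_zero])
  obtain ⟨h', hh'⟩ := factor_of_exact (d 0) ε hε h0 (k - a)
    (by rw [LinearMap.sub_comp, ha', sub_self])
  refine ⟨h', ?_⟩
  have hga : g ∘ₗ a = 0 := by
    ext x
    exact (hfg _).2 (ha x)
  ext c
  obtain ⟨z, rfl⟩ := hε c
  have h1 := LinearMap.congr_fun hh' z
  have h2 := LinearMap.congr_fun hk z
  have h3 := LinearMap.congr_fun hga z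
  simp only [LinearMap.comp_apply, LinearMap.sub_apply, LinearMap.zero_apply] at h1 h2 h3 ⊢
  rw [h1, map_sub, h2, h3, sub_zero]

lemma tensor_lift {C : Type} [AddCommGroup C] [Module R C]
    {B D Q : Type} [AddCommGroup B] [Module R B]
    [AddCommGroup D] [Module R D] [AddCommGroup Q] [Module R Q] [Module.Projective R Q]
    (g : B →ₗ[R] D)
    (hl : ∀ h : C →ₗ[R] D, (∀ x, h x ∈ LinearMap.range g) → ∃ h' : C →ₗ[R] B, g ∘ₗ h' = h)
    (h : C ⊗[R] Q →ₗ[R] D) (hh : ∀ x, h x ∈ LinearMap.range g) :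
    ∃ h' : C ⊗[R] Q →ₗ[R] B, g ∘ₗ h' = h := by
  obtain ⟨k, hk⟩ := projLift (LinearMap.compRight R g : (C →ₗ[R] B) →ₗ[R] (C →ₗ[R] D))
    (TensorProduct.curry h).flip (fun q => by
      obtain ⟨h', hh'⟩ := hl ((TensorProduct.curry h).flip q) (fun c => hh _)
      exact ⟨h', hh'⟩)
  refine ⟨TensorProduct.lift k.flip, ?_⟩
  ext c q
  exact LinearMap.congr_fun (LinearMap.congr_fun hk q) c

lemma EN_finsupp (hf : ∀ n, Module.Finite R ↥(F n)) {C : Type} [AddCommGroup C] [Module R C]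
    (hC : EN F d (⊤ : Submodule R C)) (ι : Type) : EN F d (⊤ : Submodule R (ι →₀ C)) := by
  classical
  intro n h _ hz
  have hex : ∀ i : ι, ∃ g : F n →ₗ[R] C, g ∘ₗ d n = Finsupp.lapply i ∘ₗ h := by
    intro i
    obtain ⟨g, _, hg⟩ := hC n (Finsupp.lapply i ∘ₗ h) (fun _ => Submodule.mem_top)
      (by rw [LinearMap.comp_assoc, hz, LinearMap.comp_zero])
    exact ⟨g, hg⟩
  choose g hg using hex
  have := hf (n + 1)
  obtain ⟨T, hT⟩ := (Module.Finite.fg_top : (⊤ : Submodule R (F (n + 1))).FG)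
  let U : Finset ι := T.biUnion (fun t => (h t).support)
  have hU : ∀ i, i ∉ U → ∀ x, h x i = 0 := by
    intro i hi
    have : (Finsupp.lapply i : (ι →₀ C) →ₗ[R] C) ∘ₗ h = 0 := by
      refine LinearMap.ext_on hT ?_
      intro t ht
      by_contra hne
      exact hi (Finset.mem_biUnion.2 ⟨t, ht, Finsupp.mem_support_iff.2 hne⟩)
    intro x
    exact LinearMap.congr_fun this x
  refine ⟨∑ i ∈ U, Finsupp.lsingle i ∘ₗ g i, fun _ => Submodule.mem_top, ?_⟩
  ext x j
  have hg' : ∀ i, g i (d n x) = h x i := fun i => LinearMap.congr_fun (hg i) x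
  simp only [LinearMap.comp_apply, LinearMap.sum_apply, Finsupp.lsingle_apply, hg',
    Finsupp.finsetSum_apply, Finsupp.single_apply, Finset.sum_ite_eq']
  split_ifs with hj
  · rfl
  · exact (hU j hj x).symm

lemma EN_tensor (hf : ∀ n, Module.Finite R ↥(F n)) {C : Type} [AddCommGroup C] [Module R C]
    (hC : EN F d (⊤ : Submodule R C)) (P : Type) [AddCommGroup P] [Module R P]
    [Module.Projective R P] : EN F d (⊤ : Submodule R (C ⊗[R] P)) := by
  classical
  obtain ⟨s, hs⟩ := Module.projective_def'.1 (inferInstance : Module.Projective R P)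
  intro n h _ hz
  let e := TensorProduct.finsuppScalarRight R R C P
  obtain ⟨g, _, hg⟩ := EN_finsupp hf hC P n (e.toLinearMap ∘ₗ s.lTensor C ∘ₗ h)
    (fun _ => Submodule.mem_top)
    (by rw [LinearMap.comp_assoc, LinearMap.comp_assoc, hz, LinearMap.comp_zero,
      LinearMap.comp_zero])
  refine ⟨(Finsupp.linearCombination R id).lTensor C ∘ₗ e.symm.toLinearMap ∘ₗ g,
    fun _ => Submodule.mem_top, ?_⟩
  rw [LinearMap.comp_assoc, LinearMap.comp_assoc, hg]
  ext x
  simp only [LinearMap.comp_apply, LinearEquiv.coe_coe, LinearEquiv.symm_apply_apply]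
  rw [← LinearMap.comp_apply, ← LinearMap.lTensor_comp, hs, LinearMap.lTensor_id]
  rfl

/-- Exactness is detected by `Hom(C, -)`. -/
lemma exact_of_hom (hp : ∀ n, Module.Projective R ↥(F n)) (hf : ∀ n, Module.Finite R ↥(F n))
    (hd : ∀ n, Function.Exact (d (n + 1)) (d n))
    {C : Type} [AddCommGroup C] [Module R C] (ε : ↥(F 0) →ₗ[R] C)
    (hε : Function.Surjective ε) (h0 : Function.Exact (d 0) ε)
    (hann : Module.annihilator R C = ⊥)
    {A B D : Type} [AddCommGroup A] [Module R A] [AddCommGroup B] [Module R B]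
    [AddCommGroup D] [Module R D] (f : A →ₗ[R] B) (g : B →ₗ[R] D) (hfg : g ∘ₗ f = 0)
    (hA : EN F d (LinearMap.range f))
    (hh : ∀ h : C →ₗ[R] B, g ∘ₗ h = 0 → ∃ h' : C →ₗ[R] A, f ∘ₗ h' = h) :
    Function.Exact f g := by
  intro b
  constructor
  · intro hb
    have := hp 0
    have := hf 0
    have := hf 1
    let q := (LinearMap.range f).mkQ
    have hfq : Function.Exact f q := by
      intro y
      simp [q]
    let K : Submodule R (B ⧸ LinearMap.range f) := (LinearMap.ker g).map q
    have key : ∀ x : K, x = 0 := by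
      refine eq_zero_of_hom (F1 := F 1) (d 0) ε hε h0 hann ?_
      intro h
      obtain ⟨h', hh'⟩ := EN_lift hp hd ε hε h0 f q hfq hA (K.subtype ∘ₗ h)
        (fun x => by
          obtain ⟨y, _, hy⟩ := (h x).2
          exact ⟨y, hy⟩)
      obtain ⟨h'', rfl⟩ := hh h' (by
        ext c
        obtain ⟨y, hy, hy'⟩ := (h c).2
        have h1 : q (h' c) = q y := (LinearMap.congr_fun hh' c).trans hy'.symm
        have h2 : q (h' c - y) = 0 := by rw [map_sub, h1, sub_self]
        obtain ⟨a, ha⟩ := (hfq _).1 h2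
        have h3 : g (f a) = 0 := LinearMap.congr_fun hfg a
        have hy0 : g y = 0 := hy
        rw [ha, map_sub, hy0, sub_zero] at h3
        exact h3)
      ext c
      have := LinearMap.congr_fun hh' c
      have h4 : q (f (h'' c)) = 0 := hfq.apply_apply_eq_zero _
      exact this.symm.trans h4
    have hq : q b = 0 := congrArg Subtype.val (key ⟨q b, b, hb, rfl⟩)
    exact (hfq b).1 hq
  · rintro ⟨a, rfl⟩
    exact LinearMap.congr_fun hfg a

end

lemma range_eq_bot_of_subsingleton {R A B : Type} [CommRing R] [AddCommGroup A] [Module R A]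
    [AddCommGroup B] [Module R B] [Subsingleton A] (f : A →ₗ[R] B) : LinearMap.range f = ⊥ := by
  rw [LinearMap.range_eq_bot]
  ext x
  rw [Subsingleton.elim x 0, map_zero, map_zero]

lemma hom_of_tensor {R C A B D : Type} [CommRing R] [AddCommGroup C] [Module R C]
    [AddCommGroup A] [Module R A] [AddCommGroup B] [Module R B] [AddCommGroup D] [Module R D]
    (f : A →ₗ[R] B) (g : B →ₗ[R] D)
    (H : ∀ h : C ⊗[R] R →ₗ[R] B, g ∘ₗ h = 0 → ∃ h' : C ⊗[R] R →ₗ[R] A, f ∘ₗ h' = h) :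
    ∀ h : C →ₗ[R] B, g ∘ₗ h = 0 → ∃ h' : C →ₗ[R] A, f ∘ₗ h' = h := by
  intro h hz
  obtain ⟨k, hk⟩ := H (h ∘ₗ (TensorProduct.rid R C).toLinearMap)
    (by rw [← LinearMap.comp_assoc, hz, LinearMap.zero_comp])
  refine ⟨k ∘ₗ (TensorProduct.rid R C).symm.toLinearMap, ?_⟩
  rw [← LinearMap.comp_assoc, hk]
  ext c
  simp

/-- `M` admits an augmented proper `P_C`-projective resolution vanishing in degrees `> n`
iff there is an exact sequence `0 → C ⊗ P_n → ⋯ → C ⊗ P_0 → M → 0` with each `P_i`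
projective; moreover, any such bounded exact sequence is automatically an augmented
proper `P_C`-projective resolution of `M`. -/
theorem bounded_augProperRes_iff_boundedExact
    (R : Type) [CommRing R] (C : Type) [AddCommGroup C] [Module R C]
    (M : Type) [AddCommGroup M] [Module R M] (hC : IsSemidualizing R C) (n : ℕ) :
    ((∃ (P : ℕ → ModuleCat.{0} R)
        (d : ∀ k : ℕ, (C ⊗[R] ↥(P (k + 1))) →ₗ[R] (C ⊗[R] ↥(P k)))
        (ε : (C ⊗[R] ↥(P 0)) →ₗ[R] M),
          IsAugProperRes R C M P d ε ∧ ∀ i, n < i → Subsingleton (C ⊗[R] ↥(P i))) ↔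
      HasBoundedExactCRes R C M n) ∧
    (∀ (P : ℕ → ModuleCat.{0} R)
        (d : ∀ k : ℕ, (C ⊗[R] ↥(P (k + 1))) →ₗ[R] (C ⊗[R] ↥(P k)))
        (ε : (C ⊗[R] ↥(P 0)) →ₗ[R] M),
          (∀ i, Module.Projective R ↥(P i)) → ResExact R C M P d ε →
          (∀ i, n < i → Subsingleton (C ⊗[R] ↥(P i))) →
          IsAugProperRes R C M P d ε) := by
  obtain ⟨⟨F, δ, η, hf, hp, hη, h0, hδ⟩, hhom, hext⟩ := hC
  have hann : Module.annihilator R C = ⊥ := by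
    rw [eq_bot_iff]
    intro r hr
    rw [Module.mem_annihilator] at hr
    rw [Submodule.mem_bot]
    apply hhom.1
    ext c
    simp [hr c]
  have hEC : EN F δ (⊤ : Submodule R C) := by
    intro n h _ hz
    obtain ⟨g, hg⟩ := ext_elem F δ η hp hη h0 hδ C n (hext (n + 1) (by omega)) h hz
    exact ⟨g, fun _ => Submodule.mem_top, hg⟩
  have hlift := @EN_lift R _ F δ hp hδ C _ _ η hη h0
  have moreover : ∀ (P : ℕ → ModuleCat.{0} R)
        (d : ∀ k : ℕ, (C ⊗[R] ↥(P (k + 1))) →ₗ[R] (C ⊗[R] ↥(P k)))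
        (ε : (C ⊗[R] ↥(P 0)) →ₗ[R] M),
          (∀ i, Module.Projective R ↥(P i)) → ResExact R C M P d ε →
          (∀ i, n < i → Subsingleton (C ⊗[R] ↥(P i))) →
          IsAugProperRes R C M P d ε := by
    intro P d ε hP ⟨hε, hd0, hd⟩ hn
    have hET : ∀ i, EN F δ (⊤ : Submodule R (C ⊗[R] ↥(P i))) := fun i =>
      have := hP i
      EN_tensor hf hEC _
    have hE' : ∀ m i, n ≤ i + m → EN F δ (LinearMap.range (d i)) := by
      intro m
      induction m with
      | zero =>
        intro i hi
        have := hn (i + 1) (by omega)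
        exact EN_subsingleton _ (range_eq_bot_of_subsingleton _)
      | succ m ih =>
        intro i hi
        exact EN_range hp hδ (d (i + 1)) (d i) (hd i) (ih (i + 1) (by omega)) (hET _)
    have hE : ∀ i, EN F δ (LinearMap.range (d i)) := fun i => hE' n i (by omega)
    refine ⟨hP, fun n => (hd n).linearMap_comp_eq_zero, hd0.linearMap_comp_eq_zero, ?_⟩
    intro Q _ _ hQ
    refine ⟨?_, ?_, ?_⟩
    · intro h
      exact tensor_lift ε (hlift (d 0) ε hd0 (hE 0)) h (fun x => hε _)
    · intro h
      constructor
      · intro hz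
        exact tensor_lift (d 0) (hlift (d 1) (d 0) (hd 0) (hE 1)) h
          (fun x => (hd0 _).1 (LinearMap.congr_fun hz x))
      · rintro ⟨k, rfl⟩
        ext c q
        exact hd0.apply_apply_eq_zero _
    · intro i h
      constructor
      · intro hz
        exact tensor_lift (d (i + 1)) (hlift (d (i + 2)) (d (i + 1)) (hd (i + 1)) (hE (i + 2))) h
          (fun x => (hd i _).1 (LinearMap.congr_fun hz x))
      · rintro ⟨k, rfl⟩
        ext c q
        exact (hd i).apply_apply_eq_zero _
  refine ⟨⟨?_, ?_⟩, moreover⟩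
  · rintro ⟨P, d, ε, ⟨hP, hdd, hεd, hprop⟩, hn⟩
    refine ⟨P, d, ε, hP, ?_, hn⟩
    obtain ⟨hs, he0, he⟩ := hprop R inferInstance
    have hET : ∀ i, EN F δ (⊤ : Submodule R (C ⊗[R] ↥(P i))) := fun i =>
      have := hP i
      EN_tensor hf hEC _
    have hstep : ∀ i, EN F δ (LinearMap.range (d (i + 1))) → Function.Exact (d (i + 1)) (d i) := by
      intro i hi
      refine exact_of_hom hp hf hδ η hη h0 hann _ _ (hdd i) hi ?_
      exact hom_of_tensor _ _ (fun h hz => (he i h).1 hz)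
    have hE' : ∀ m i, n ≤ i + m → EN F δ (LinearMap.range (d i)) := by
      intro m
      induction m with
      | zero =>
        intro i hi
        have := hn (i + 1) (by omega)
        exact EN_subsingleton _ (range_eq_bot_of_subsingleton _)
      | succ m ih =>
        intro i hi
        have h1 := ih (i + 1) (by omega)
        exact EN_range hp hδ (d (i + 1)) (d i) (hstep i h1) h1 (hET _)
    have hE : ∀ i, EN F δ (LinearMap.range (d i)) := fun i => hE' n i (by omega)
    have hx0 : Function.Exact (d 0) ε := by
      refine exact_of_hom hp hf hδ η hη h0 hann _ _ hεd (hE 0) ?_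
      exact hom_of_tensor _ _ (fun h hz => (he0 h).1 hz)
    refine ⟨?_, hx0, fun i => hstep i (hE _)⟩
    have hx1 : Function.Exact ε (0 : M →ₗ[R] PUnit.{1}) := by
      refine exact_of_hom hp hf hδ η hη h0 hann _ _ (LinearMap.zero_comp _)
        (EN_range hp hδ (d 0) ε hx0 (hE 0) (hET 0)) ?_
      exact hom_of_tensor _ _ (fun h _ => hs h)
    exact fun m => (hx1 m).1 rfl
  · rintro ⟨P, d, ε, hP, hex, hn⟩
    exact ⟨P, d, ε, moreover P d ε hP hex hn, hn⟩

end
end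

section
/- Let R be a commutative ring, C a semidualizing R-module, M an R-module, and n a nonnegative integer. Then there exists an exact sequence 0 → C ⊗_R P_n → ⋯ → C ⊗_R P_1 → C ⊗_R P_0 → M → 0 with each P_i a projective R-module if and only if Hom_R(C,M) has projective dimension at most n. Consequently the P_C-projective dimension of M equals pd_R(Hom_R(C,M)). -/
open TensorProduct CategoryTheory

noncomputable section

theorem sdz_hom_exact_of_ext (R : Type) [CommRing R] (C N : Type) [AddCommGroup C] [Module R C]
    [AddCommGroup N] [Module R N]
    (F : ℕ → ModuleCat.{0} R) (d : ∀ n, ↥(F (n + 1)) →ₗ[R] ↥(F n)) (ε : ↥(F 0) →ₗ[R] C)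
    (hproj : ∀ n, Module.Projective R ↥(F n)) (hε : Function.Surjective ε)
    (h0 : Function.Exact (d 0) ε) (hs : ∀ n, Function.Exact (d (n + 1)) (d n)) (i : ℕ)
    (hext : Subsingleton (((Ext R (ModuleCat R) (i + 1)).obj
      (Opposite.op (ModuleCat.of R C))).obj (ModuleCat.of R N)))
    (g : F (i + 1) →ₗ[R] N) (hg : g ∘ₗ d (i + 1) = 0) :
    ∃ h : F i →ₗ[R] N, g = h ∘ₗ d i := by
  let K : ChainComplex (ModuleCat.{0} R) ℕ := ChainComplex.of F (fun n => ModuleCat.ofHom (d n))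
    (fun n => by
      ext x
      exact (hs n).apply_apply_eq_zero x)
  have hKd : ∀ n, K.d (n + 1) n = ModuleCat.ofHom (d n) := fun n =>
    ChainComplex.of_d (V := ModuleCat.{0} R) F (fun n => ModuleCat.ofHom (d n)) n
  have hKex : ∀ n, K.ExactAt (n + 1) := by
    intro n
    rw [HomologicalComplex.exactAt_iff' _ (n + 1 + 1) (n + 1) n (by simp) (by simp)]
    rw [ShortComplex.moduleCat_exact_iff]
    intro x hx
    change (K.d (n + 1) n) x = 0 at hx
    change ∃ y, (K.d (n + 1 + 1) (n + 1)) y = x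
    rw [hKd] at hx ⊢
    exact (hs n x).1 hx
  let π : K ⟶ (ChainComplex.single₀ (ModuleCat.{0} R)).obj (ModuleCat.of R C) :=
    (ChainComplex.toSingle₀Equiv _ _).symm ⟨ModuleCat.ofHom ε, by
      rw [hKd]
      ext x
      exact h0.apply_apply_eq_zero x⟩
  have hπ0 : π.f 0 = ModuleCat.ofHom ε := ChainComplex.toSingle₀Equiv_symm_apply_f_zero _ _
  let P : ProjectiveResolution (ModuleCat.of R C) :=
    { complex := K
      projective := fun n => (IsProjective.iff_projective (R := R) (F n)).1 (hproj n)
      π := π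
      quasiIso := ⟨fun n => by
        cases n with
        | zero =>
          rw [ChainComplex.quasiIsoAt₀_iff, ShortComplex.quasiIso_iff_of_zeros' _ rfl rfl rfl]
          constructor
          · rw [ShortComplex.moduleCat_exact_iff]
            intro x hx
            change π.f 0 x = 0 at hx
            change ∃ y, (K.d 1 0) y = x
            rw [hπ0] at hx
            rw [hKd]
            exact (h0 x).1 hx
          · change Epi (π.f 0)
            rw [hπ0]
            exact (ModuleCat.epi_iff_surjective _).2 hε
        | succ n =>
          rw [quasiIsoAt_iff_exactAt']
          · apply hKex
          · apply ChainComplex.exactAt_succ_single_obj⟩ }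
  have hz : Limits.IsZero ((P.complex.linearYonedaObj R (ModuleCat.of R N)).homology (i + 1)) :=
    (ModuleCat.isZero_of_subsingleton (M := ((Ext R (ModuleCat R) (i + 1)).obj
      (Opposite.op (ModuleCat.of R C))).obj (ModuleCat.of R N))).of_iso
      (P.isoExt (R := R) (i + 1) (ModuleCat.of R N)).symm
  rw [← HomologicalComplex.exactAt_iff_isZero_homology,
    HomologicalComplex.exactAt_iff' _ i (i + 1) (i + 1 + 1) (by simp) (by simp),
    ShortComplex.moduleCat_exact_iff] at hz
  obtain ⟨y, hy⟩ := hz (ModuleCat.ofHom g : K.X (i + 1) ⟶ ModuleCat.of R N) (by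
    change K.d (i + 1 + 1) (i + 1) ≫ (ModuleCat.ofHom g : K.X (i + 1) ⟶ ModuleCat.of R N) = 0
    rw [hKd]
    ext x
    exact LinearMap.congr_fun hg x)
  change K.d (i + 1) i ≫ (y : K.X i ⟶ ModuleCat.of R N) = _ at hy
  refine ⟨ModuleCat.Hom.hom (y : K.X i ⟶ ModuleCat.of R N), ?_⟩
  rw [hKd] at hy
  have := congrArg ModuleCat.Hom.hom hy
  exact this.symm

/-- `Hom(F, N)` is exact in positive degrees. -/
def SdzAcyc {R : Type} [CommRing R] (F : ℕ → ModuleCat.{0} R)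
    (d : ∀ n, ↥(F (n + 1)) →ₗ[R] ↥(F n)) (N : Type) [AddCommGroup N] [Module R N] : Prop :=
  ∀ (i : ℕ) (g : F (i + 1) →ₗ[R] N), g ∘ₗ d (i + 1) = 0 → ∃ h : F i →ₗ[R] N, g = h ∘ₗ d i

section faithful
variable {R : Type} [CommRing R]

theorem sdz_faithful_aux {C : Type} [AddCommGroup C] [Module R C]
    {N : Type} [AddCommGroup N] [Module R N] (s : Finset C) :
    (∀ f : Submodule.span R (s : Set C) →ₗ[R] N, f = 0) →
    ∀ x : N, x ≠ 0 → ∃ a : R, (∀ c ∈ Submodule.span R (s : Set C), a • c = 0) ∧ a • x ≠ 0 := by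
  classical
  induction s using Finset.induction_on with
  | empty =>
    intro _ x hx
    refine ⟨1, ?_, by simpa using hx⟩
    intro c hc
    simpa using hc
  | insert c s _ ih =>
    intro hf
    set K := Submodule.span R (s : Set C) with hK
    set L := Submodule.span R ((insert c s : Finset C) : Set C) with hL
    have hKL : K ≤ L := Submodule.span_mono (by simp)
    have hcL : c ∈ L := Submodule.subset_span (by simp)
    -- elements of `L` modulo `K`
    have hmem : ∀ y ∈ L, ∃ r : R, ∃ k ∈ K, y = r • c + k := by
      intro y hy
      rw [hL, Finset.coe_insert, Submodule.mem_span_insert] at hy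
      exact hy
    -- step 1
    have h1 : ∀ x : N, x ≠ 0 → ∃ a : R, a • c ∈ K ∧ a • x ≠ 0 := by
      intro x hx
      by_contra! hcon
      -- build a map to N through the cyclic quotient
      let q : R →ₗ[R] (L ⧸ K.submoduleOf L) :=
        (K.submoduleOf L).mkQ ∘ₗ LinearMap.toSpanSingleton R L ⟨c, hcL⟩
      have hq : Function.Surjective q := by
        intro z
        obtain ⟨⟨y, hy⟩, rfl⟩ := Submodule.mkQ_surjective _ z
        obtain ⟨r, k, hk, rfl⟩ := hmem y hy
        refine ⟨r, ?_⟩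
        simp only [q, LinearMap.comp_apply, Submodule.mkQ_apply]
        rw [Submodule.Quotient.eq]
        simp only [Submodule.submoduleOf, Submodule.mem_comap]
        simpa using hk
      have hker : LinearMap.ker q ≤ LinearMap.ker (LinearMap.toSpanSingleton R N x) := by
        intro a ha
        have : a • c ∈ K := by
          have ha' : q a = 0 := ha
          simp only [q, LinearMap.comp_apply, Submodule.mkQ_apply] at ha'
          rw [Submodule.Quotient.mk_eq_zero] at ha'
          simpa [Submodule.submoduleOf] using ha'
        simpa using hcon a this
      let e := q.quotKerEquivOfSurjective hq
      let f : L →ₗ[R] N := ((LinearMap.ker q).liftQ _ hker) ∘ₗ e.symm.toLinearMap ∘ₗ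
        (K.submoduleOf L).mkQ
      have hfc : f ⟨c, hcL⟩ = x := by
        have : (K.submoduleOf L).mkQ ⟨c, hcL⟩ = e (Submodule.Quotient.mk 1) := by
          change _ = q 1
          simp [q]
        simp only [f, LinearMap.comp_apply, this, LinearEquiv.coe_coe, LinearEquiv.symm_apply_apply]
        rw [Submodule.liftQ_apply]
        simp
      rw [hf f] at hfc
      exact hx hfc.symm
    have h2 : ∀ f : K →ₗ[R] N, f = 0 := by
      intro f
      by_contra hne
      obtain ⟨k, hk⟩ : ∃ k, f k ≠ 0 := by
        by_contra! h
        exact hne (LinearMap.ext h)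
      obtain ⟨a, ha, hax⟩ := h1 _ hk
      have haL : ∀ y ∈ L, a • y ∈ K := by
        intro y hy
        obtain ⟨r, k, hk, rfl⟩ := hmem y hy
        rw [smul_add, smul_comm]
        exact K.add_mem (K.smul_mem _ ha) (K.smul_mem _ hk)
      let m : L →ₗ[R] K := LinearMap.codRestrict K (a • L.subtype) (fun y => haL y y.2)
      have := LinearMap.congr_fun (hf (f ∘ₗ m)) ⟨k, hKL k.2⟩
      have hm : m ⟨k, hKL k.2⟩ = a • k := by
        rfl
      rw [LinearMap.comp_apply, hm, map_smul] at this
      exact hax this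
    intro x hx
    obtain ⟨a, ha, hax⟩ := h1 x hx
    obtain ⟨b, hb, hbx⟩ := ih h2 _ hax
    refine ⟨b * a, ?_, by rwa [mul_smul]⟩
    intro y hy
    obtain ⟨r, k, hk, rfl⟩ := hmem y hy
    rw [smul_add, mul_smul, mul_smul, smul_comm a r c, hb _ (K.smul_mem _ ha),
      hb _ (K.smul_mem _ hk), add_zero]

theorem sdz_faithful {C : Type} [AddCommGroup C] [Module R C] [Module.Finite R C]
    (hC : ∀ a : R, (∀ c : C, a • c = 0) → a = 0)
    {N : Type} [AddCommGroup N] [Module R N] (h : ∀ f : C →ₗ[R] N, f = 0) (x : N) : x = 0 := by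
  by_contra hx
  obtain ⟨s, hs⟩ := (Module.Finite.fg_top (R := R) (M := C))
  obtain ⟨a, ha, hax⟩ := sdz_faithful_aux (N := N) s (fun f => by
    have hm : ∀ c : C, c ∈ Submodule.span R (s : Set C) := fun c => by rw [hs]; trivial
    have h0 := h (f ∘ₗ LinearMap.codRestrict _ LinearMap.id hm)
    ext y
    exact LinearMap.congr_fun h0 y.1) x hx
  apply hax
  rw [hC a (fun c => ha c (by rw [hs]; trivial)), zero_smul]
end faithful

section acyc
variable {R : Type} [CommRing R] {F : ℕ → ModuleCat.{0} R}
    {d : ∀ n, ↥(F (n + 1)) →ₗ[R] ↥(F n)}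

theorem SdzAcyc.of_retract {N N' : Type} [AddCommGroup N] [Module R N]
    [AddCommGroup N'] [Module R N'] (h : SdzAcyc F d N) (s : N' →ₗ[R] N) (p : N →ₗ[R] N')
    (hps : p ∘ₗ s = LinearMap.id) : SdzAcyc F d N' := by
  intro i g hg
  obtain ⟨k, hk⟩ := h i (s ∘ₗ g) (by rw [LinearMap.comp_assoc, hg, LinearMap.comp_zero])
  refine ⟨p ∘ₗ k, ?_⟩
  rw [LinearMap.comp_assoc, ← hk, ← LinearMap.comp_assoc, hps, LinearMap.id_comp]

theorem SdzAcyc.of_subsingleton {N : Type} [AddCommGroup N] [Module R N] [Subsingleton N] :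
    SdzAcyc F d N := fun i g _ => ⟨0, by ext; exact Subsingleton.elim _ _⟩

/-- A map from a finite module to a finitely supported function module has uniform support. -/
theorem sdz_finite_support {X C I : Type} [AddCommGroup X] [Module R X] [Module.Finite R X]
    [AddCommGroup C] [Module R C] (g : X →ₗ[R] (I →₀ C)) :
    ∃ t : Finset I, ∀ x, ∀ j ∉ t, g x j = 0 := by
  classical
  obtain ⟨s, hs⟩ := (Module.Finite.fg_top (R := R) (M := X))
  refine ⟨s.biUnion fun x => (g x).support, fun x j hj => ?_⟩
  have hx : x ∈ Submodule.span R (s : Set X) := by rw [hs]; trivial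
  induction hx using Submodule.span_induction with
  | mem x hx =>
    by_contra hne
    exact hj (Finset.mem_biUnion.2 ⟨x, hx, Finsupp.mem_support_iff.2 hne⟩)
  | zero => simp
  | add x y _ _ hx hy => simp [hx, hy]
  | smul a x _ hx => simp [hx]

theorem SdzAcyc.finsupp {C : Type} [AddCommGroup C] [Module R C] (I : Type)
    (hF : ∀ n, Module.Finite R (F n)) (h : SdzAcyc F d C) : SdzAcyc F d (I →₀ C) := by
  classical
  intro i g hg
  obtain ⟨t, ht⟩ := sdz_finite_support g
  have hj : ∀ j, ∃ k : F i →ₗ[R] C, Finsupp.lapply j ∘ₗ g = k ∘ₗ d i := fun j =>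
    h i _ (by rw [LinearMap.comp_assoc, hg, LinearMap.comp_zero])
  choose k hk using hj
  refine ⟨∑ j ∈ t, Finsupp.lsingle j ∘ₗ k j, ?_⟩
  ext x j
  have hkj := LinearMap.congr_fun (hk j) x
  simp only [LinearMap.comp_apply, Finsupp.lapply_apply] at hkj
  simp only [LinearMap.comp_apply, LinearMap.sum_apply, Finsupp.lsingle_apply,
    Finsupp.finsetSum_apply, Finsupp.single_apply, Finset.sum_ite_eq', ← hkj]
  split_ifs with hjt
  · rfl
  · exact ht x j hjt

theorem SdzAcyc.tensor {C : Type} [AddCommGroup C] [Module R C] (P : Type) [AddCommGroup P]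
    [Module R P] [Module.Projective R P]
    (hF : ∀ n, Module.Finite R (F n)) (h : SdzAcyc F d C) : SdzAcyc F d (C ⊗[R] P) := by
  classical
  obtain ⟨s, hs⟩ := (Module.projective_def'.1 (inferInstance : Module.Projective R P))
  have h1 : SdzAcyc F d (C ⊗[R] (P →₀ R)) :=
    (SdzAcyc.finsupp P hF h).of_retract
      (TensorProduct.finsuppScalarRight R R C P).toLinearMap
      (TensorProduct.finsuppScalarRight R R C P).symm.toLinearMap (by ext; simp)
  refine h1.of_retract (s.lTensor C) (LinearMap.lTensor C (Finsupp.linearCombination R id)) ?_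
  rw [← LinearMap.lTensor_comp, hs, LinearMap.lTensor_id]

/-- Lifting maps from `C`, when the kernel is acyclic. -/
theorem sdz_lift {C : Type} [AddCommGroup C] [Module R C] {ε : F 0 →ₗ[R] C}
    (hproj : ∀ n, Module.Projective R (F n)) (hε : Function.Surjective ε)
    (h0 : Function.Exact (d 0) ε) (hs : ∀ n, Function.Exact (d (n + 1)) (d n))
    {X Y : Type} [AddCommGroup X] [Module R X] [AddCommGroup Y] [Module R Y]
    (u : X →ₗ[R] Y) (hu : SdzAcyc F d (LinearMap.ker u)) (f : C →ₗ[R] Y)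
    (hf : ∀ c, f c ∈ LinearMap.range u) : ∃ f' : C →ₗ[R] X, u ∘ₗ f' = f := by
  have := hproj 0
  obtain ⟨g, hg⟩ := Module.projective_lifting_property u.rangeRestrict
    (LinearMap.codRestrict (LinearMap.range u) (f ∘ₗ ε) (fun x => hf _)) u.surjective_rangeRestrict
  have hg' : ∀ x, u (g x) = f (ε x) := fun x => congrArg Subtype.val (LinearMap.congr_fun hg x)
  let k : F 1 →ₗ[R] LinearMap.ker u := LinearMap.codRestrict _ (g ∘ₗ d 0) (fun x => by
    simp [hg', h0.apply_apply_eq_zero])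
  obtain ⟨h, hh⟩ := hu 0 k (by
    ext x
    simp [k, (hs 0).apply_apply_eq_zero])
  let g2 : F 0 →ₗ[R] X := g - (LinearMap.ker u).subtype ∘ₗ h
  have hg2 : LinearMap.ker ε ≤ LinearMap.ker g2 := by
    intro x hx
    obtain ⟨y, rfl⟩ := (h0 x).1 hx
    have := congrArg Subtype.val (LinearMap.congr_fun hh y)
    simp only [k, LinearMap.codRestrict_apply, LinearMap.comp_apply] at this
    simp [g2, this]
  refine ⟨(LinearMap.ker ε).liftQ g2 hg2 ∘ₗ (ε.quotKerEquivOfSurjective hε).symm.toLinearMap, ?_⟩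
  ext c
  obtain ⟨x, rfl⟩ := hε c
  have : (ε.quotKerEquivOfSurjective hε).symm (ε x) = Submodule.Quotient.mk x := by
    rw [LinearEquiv.symm_apply_eq]; rfl
  simp [this, g2, hg']

theorem SdzAcyc.range (hproj : ∀ n, Module.Projective R (F n))
    (hs : ∀ n, Function.Exact (d (n + 1)) (d n))
    {X Y : Type} [AddCommGroup X] [Module R X] [AddCommGroup Y] [Module R Y]
    (u : X →ₗ[R] Y) (hu : SdzAcyc F d (LinearMap.ker u)) (hX : SdzAcyc F d X) :
    SdzAcyc F d (LinearMap.range u) := by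
  intro i g hg
  have := hproj (i + 1)
  obtain ⟨g', hg'⟩ := Module.projective_lifting_property u.rangeRestrict g
    u.surjective_rangeRestrict
  have hgu : ∀ x, u (g' x) = g x := fun x => congrArg Subtype.val (LinearMap.congr_fun hg' x)
  let k : F (i + 2) →ₗ[R] LinearMap.ker u := LinearMap.codRestrict _ (g' ∘ₗ d (i + 1)) (fun x => by
    have := congrArg Subtype.val (LinearMap.congr_fun hg x)
    simpa [hgu] using this)
  obtain ⟨h, hh⟩ := hu (i + 1) k (by
    ext x
    simp [k, (hs (i + 1)).apply_apply_eq_zero])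
  obtain ⟨l, hl⟩ := hX i (g' - (LinearMap.ker u).subtype ∘ₗ h) (by
    ext x
    have := congrArg Subtype.val (LinearMap.congr_fun hh x)
    simp only [k, LinearMap.codRestrict_apply, LinearMap.comp_apply] at this
    simp [this])
  refine ⟨u.rangeRestrict ∘ₗ l, ?_⟩
  rw [LinearMap.comp_assoc, ← hl]
  ext x
  simp [hgu]

/-- Exactness is detected by maps out of C. -/
theorem sdz_exact_of_hom {C : Type} [AddCommGroup C] [Module R C] {ε : F 0 →ₗ[R] C}
    (hproj : ∀ n, Module.Projective R (F n)) (hε : Function.Surjective ε)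
    (h0 : Function.Exact (d 0) ε) (hs : ∀ n, Function.Exact (d (n + 1)) (d n))
    [Module.Finite R C] (hC : ∀ a : R, (∀ c : C, a • c = 0) → a = 0)
    {X Y Z : Type} [AddCommGroup X] [Module R X] [AddCommGroup Y] [Module R Y]
    [AddCommGroup Z] [Module R Z] (u : X →ₗ[R] Y) (v : Y →ₗ[R] Z) (huv : ∀ x, v (u x) = 0)
    (hu : SdzAcyc F d (LinearMap.range u))
    (hom : ∀ f : C →ₗ[R] Y, v ∘ₗ f = 0 → ∃ f' : C →ₗ[R] X, u ∘ₗ f' = f) :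
    Function.Exact u v := by
  intro y
  refine ⟨fun hy => ?_, fun ⟨x, hx⟩ => hx ▸ huv x⟩
  let Q := (LinearMap.range u).mkQ
  let q : LinearMap.ker v →ₗ[R] (Y ⧸ LinearMap.range u) := Q ∘ₗ (LinearMap.ker v).subtype
  have hall : ∀ f : C →ₗ[R] LinearMap.range q, f = 0 := by
    intro f
    obtain ⟨f', hf'⟩ := sdz_lift hproj hε h0 hs Q
      (by rw [Submodule.ker_mkQ]; exact hu) ((LinearMap.range q).subtype ∘ₗ f)
      (fun c => Submodule.mkQ_surjective _ _)
    have hvf : ∀ c, f' c ∈ LinearMap.ker v := by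
      intro c
      obtain ⟨⟨z, hz⟩, hzc⟩ := (f c).2
      have h1 : Q (f' c) = Q z := (LinearMap.congr_fun hf' c).trans hzc.symm
      obtain ⟨x, hx⟩ := (Submodule.Quotient.eq _).1 h1
      have : f' c = u x + z := by rw [hx]; abel
      rw [LinearMap.mem_ker, this, map_add, huv, LinearMap.mem_ker.1 hz, add_zero]
    obtain ⟨f'', hf''⟩ := hom f' (LinearMap.ext hvf)
    ext c
    have h1 : Q (f' c) = f c := LinearMap.congr_fun hf' c
    rw [← h1, ← hf'']
    exact (Submodule.Quotient.mk_eq_zero _).2 ⟨f'' c, rfl⟩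
  have := sdz_faithful hC hall ⟨q ⟨y, hy⟩, ⟨_, rfl⟩⟩
  have h2 : Q y = 0 := congrArg Subtype.val this
  exact (Submodule.Quotient.mk_eq_zero _).1 h2
end acyc

section mu
variable {R : Type} [CommRing R] {C : Type} [AddCommGroup C] [Module R C] [Module.Finite R C]

/-- For projective `P`, each map `C → C ⊗ P` is `c ↦ c ⊗ p` for a unique `p`. -/
theorem sdz_mu_bij (hb : Function.Bijective (fun r : R => (r • LinearMap.id : C →ₗ[R] C)))
    (P : Type) [AddCommGroup P] [Module R P] [Module.Projective R P] :
    Function.Bijective ((TensorProduct.mk R C P).flip) := by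
  classical
  obtain ⟨s, hs⟩ := (Module.projective_def'.1 (inferInstance : Module.Projective R P))
  let p : (P →₀ R) →ₗ[R] P := Finsupp.linearCombination R id
  have hps : ∀ x, p (s x) = x := fun x => LinearMap.congr_fun hs x
  let e := TensorProduct.finsuppScalarRight R R C P
  constructor
  · rw [← LinearMap.ker_eq_bot, LinearMap.ker_eq_bot']
    intro x hx
    have h1 : s x = 0 := by
      ext j
      apply hb.1
      ext c
      have h2 : c ⊗ₜ[R] x = 0 := LinearMap.congr_fun hx c
      have h3 := congrArg (fun z => e (s.lTensor C z) j) h2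
      simpa [e] using h3
    rw [← hps x, h1, map_zero]
  · intro f
    let g : C →ₗ[R] (P →₀ C) := e.toLinearMap ∘ₗ s.lTensor C ∘ₗ f
    obtain ⟨t, ht⟩ := sdz_finite_support g
    have hr : ∀ j, ∃ r : R, r • LinearMap.id = Finsupp.lapply j ∘ₗ g := fun j => hb.2 _
    choose r hr using hr
    let y : P →₀ R := ∑ j ∈ t, Finsupp.single j (r j)
    refine ⟨p y, ?_⟩
    ext c
    have h1 : g c = e (c ⊗ₜ y) := by
      ext j
      have := LinearMap.congr_fun (hr j) c
      simp only [LinearMap.smul_apply, LinearMap.id_apply, LinearMap.comp_apply,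
        Finsupp.lapply_apply] at this
      simp only [e, TensorProduct.finsuppScalarRight_apply_tmul_apply, y,
        Finsupp.finsetSum_apply, Finsupp.single_apply, Finset.sum_ite_eq']
      split_ifs with hj
      · exact this.symm
      · rw [zero_smul]; exact ht c j hj
    have h2 : s.lTensor C (f c) = c ⊗ₜ y := e.injective h1
    have h3 : p.lTensor C (s.lTensor C (f c)) = f c := by
      rw [← LinearMap.comp_apply, ← LinearMap.lTensor_comp, hs, LinearMap.lTensor_id]; rfl
    rw [← h3, h2]
    simp
end mu

theorem sdz_forward {R : Type} [CommRing R] {F : ℕ → ModuleCat.{0} R}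
    {d : ∀ n, ↥(F (n + 1)) →ₗ[R] ↥(F n)} {C : Type} [AddCommGroup C] [Module R C]
    {ε : F 0 →ₗ[R] C} (hF : ∀ n, Module.Finite R (F n))
    (hproj : ∀ n, Module.Projective R (F n)) (hε : Function.Surjective ε)
    (h0 : Function.Exact (d 0) ε) (hs : ∀ n, Function.Exact (d (n + 1)) (d n))
    [Module.Finite R C]
    (hb : Function.Bijective (fun r : R => (r • LinearMap.id : C →ₗ[R] C)))
    (hacyc : SdzAcyc F d C) (M : Type) [AddCommGroup M] [Module R M] (n : ℕ)
    (h : HasBoundedExactCRes R C M n) : HasProjDimLE R (C →ₗ[R] M) n := by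
  obtain ⟨P, δ, η, hP, ⟨hη, hη0, hδ⟩, hsub⟩ := h
  have hten : ∀ i, SdzAcyc F d (C ⊗[R] P i) := fun i =>
    have := hP i
    SdzAcyc.tensor (P i) hF hacyc
  have key : ∀ k i, n ≤ i + k → SdzAcyc F d (LinearMap.range (δ i)) := by
    intro k
    induction k with
    | zero =>
      intro i hi
      have h1 : Subsingleton (C ⊗[R] P (i + 1)) := hsub _ (by omega)
      have h2 : Subsingleton (LinearMap.range (δ i)) :=
        (δ i).surjective_rangeRestrict.subsingleton
      exact SdzAcyc.of_subsingleton
    | succ k ih =>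
      intro i hi
      refine SdzAcyc.range hproj hs _ ?_ (hten _)
      rw [(hδ i).linearMap_ker_eq]
      exact ih _ (by omega)
  have hr : ∀ i, SdzAcyc F d (LinearMap.range (δ i)) := fun i => key n i (by omega)
  refine ⟨fun i => ModuleCat.of R (C →ₗ[R] C ⊗[R] P i), fun i => LinearMap.compRight R (δ i),
    LinearMap.compRight R η, fun i => ?_, ?_, ?_, fun i => ?_, fun i hi => ?_⟩
  · have := hP i
    exact Module.Projective.of_equiv (LinearEquiv.ofBijective _ (sdz_mu_bij hb (P i)))
  · intro f
    exact sdz_lift hproj hε h0 hs η (by rw [hη0.linearMap_ker_eq]; exact hr 0) f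
      (fun c => hη _)
  · intro f
    constructor
    · intro hf
      exact sdz_lift hproj hε h0 hs (δ 0) (by rw [(hδ 0).linearMap_ker_eq]; exact hr 1) f
        (fun c => (hη0 _).1 (LinearMap.congr_fun hf c))
    · rintro ⟨g, rfl⟩
      exact LinearMap.ext fun c => hη0.apply_apply_eq_zero _
  · intro f
    constructor
    · intro hf
      exact sdz_lift hproj hε h0 hs (δ (i + 1))
        (by rw [(hδ (i + 1)).linearMap_ker_eq]; exact hr (i + 2)) f
        (fun c => (hδ i _).1 (LinearMap.congr_fun hf c))
    · rintro ⟨g, rfl⟩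
      exact LinearMap.ext fun c => (hδ i).apply_apply_eq_zero _
  · have := hsub i hi
    exact ⟨fun f g => LinearMap.ext fun c => Subsingleton.elim (α := C ⊗[R] P i) _ _⟩

theorem sdz_backward {R : Type} [CommRing R] {F : ℕ → ModuleCat.{0} R}
    {d : ∀ n, ↥(F (n + 1)) →ₗ[R] ↥(F n)} {C : Type} [AddCommGroup C] [Module R C]
    {ε : F 0 →ₗ[R] C} (hF : ∀ n, Module.Finite R (F n))
    (hproj : ∀ n, Module.Projective R (F n)) (hε : Function.Surjective ε)
    (h0 : Function.Exact (d 0) ε) (hs : ∀ n, Function.Exact (d (n + 1)) (d n))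
    [Module.Finite R C]
    (hb : Function.Bijective (fun r : R => (r • LinearMap.id : C →ₗ[R] C)))
    (hacyc : SdzAcyc F d C) (M : Type) [AddCommGroup M] [Module R M] (n : ℕ)
    (h : HasProjDimLE R (C →ₗ[R] M) n) : HasBoundedExactCRes R C M n := by
  have hC : ∀ a : R, (∀ c : C, a • c = 0) → a = 0 := fun a ha =>
    hb.1 (LinearMap.ext fun c => by simp [ha c])
  obtain ⟨Q, δ, η, hQ, hη, hη0, hδ, hsub⟩ := h
  have hten : ∀ i, SdzAcyc F d (C ⊗[R] Q i) := fun i =>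
    have := hQ i
    SdzAcyc.tensor (Q i) hF hacyc
  have hmu : ∀ i, Function.Bijective ((TensorProduct.mk R C (Q i)).flip) := fun i =>
    have := hQ i
    sdz_mu_bij hb (Q i)
  let D : ∀ i, (C ⊗[R] Q (i + 1)) →ₗ[R] (C ⊗[R] Q i) := fun i => (δ i).lTensor C
  let E : (C ⊗[R] Q 0) →ₗ[R] M := TensorProduct.lift η.flip
  have hDt : ∀ i c q, D i (c ⊗ₜ q) = c ⊗ₜ δ i q := fun i c q => by simp [D]
  have hEt : ∀ c q, E (c ⊗ₜ q) = η q c := fun c q => by simp [E]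
  have hDD : ∀ i x, D i (D (i + 1) x) = 0 := by
    intro i x
    have : D i ∘ₗ D (i + 1) = 0 := by
      ext c q
      simp [hDt, (hδ i).apply_apply_eq_zero]
    exact LinearMap.congr_fun this x
  have hED : ∀ x, E (D 0 x) = 0 := by
    intro x
    have : E ∘ₗ D 0 = 0 := by
      ext c q
      simp [hDt, hEt, hη0.apply_apply_eq_zero]
    exact LinearMap.congr_fun this x
  have hex : ∀ i, SdzAcyc F d (LinearMap.range (D (i + 1))) →
      Function.Exact (D (i + 1)) (D i) := by
    intro i hi
    refine sdz_exact_of_hom hproj hε h0 hs hC _ _ (hDD i) hi ?_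
    intro f hf
    obtain ⟨q, rfl⟩ := (hmu (i + 1)).2 f
    have hq : δ i q = 0 := by
      apply (hmu i).1
      rw [map_zero, ← hf]
      ext c
      exact (hDt i c q).symm
    obtain ⟨q', rfl⟩ := (hδ i q).1 hq
    refine ⟨(TensorProduct.mk R C (Q (i + 2))).flip q', ?_⟩
    ext c
    exact hDt _ _ _
  have key : ∀ k i, n ≤ i + k → SdzAcyc F d (LinearMap.range (D i)) := by
    intro k
    induction k with
    | zero =>
      intro i hi
      have h1 : Subsingleton (Q (i + 1)) := hsub _ (by omega)
      have h3 : Subsingleton (C ⊗[R] Q (i + 1)) := inferInstance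
      have h2 : Subsingleton (LinearMap.range (D i)) :=
        (D i).surjective_rangeRestrict.subsingleton
      exact SdzAcyc.of_subsingleton
    | succ k ih =>
      intro i hi
      have h1 := ih (i + 1) (by omega)
      refine SdzAcyc.range hproj hs _ ?_ (hten _)
      rw [(hex i h1).linearMap_ker_eq]
      exact h1
  have hr : ∀ i, SdzAcyc F d (LinearMap.range (D i)) := fun i => key n i (by omega)
  have hE0 : Function.Exact (D 0) E := by
    refine sdz_exact_of_hom hproj hε h0 hs hC _ _ hED (hr 0) ?_
    intro f hf
    obtain ⟨q, rfl⟩ := (hmu 0).2 f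
    have hq : η q = 0 := by
      rw [← hf]
      ext c
      exact (hEt c q).symm
    obtain ⟨q', rfl⟩ := (hη0 q).1 hq
    refine ⟨(TensorProduct.mk R C (Q 1)).flip q', ?_⟩
    ext c
    exact hDt _ _ _
  have hEr : SdzAcyc F d (LinearMap.range E) := by
    refine SdzAcyc.range hproj hs _ ?_ (hten _)
    rw [hE0.linearMap_ker_eq]
    exact hr 0
  have hEs : Function.Exact E (0 : M →ₗ[R] M) := by
    refine sdz_exact_of_hom hproj hε h0 hs hC _ _ (fun _ => rfl) hEr ?_
    intro f _
    obtain ⟨q, rfl⟩ := hη f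
    refine ⟨(TensorProduct.mk R C (Q 0)).flip q, ?_⟩
    ext c
    exact hEt _ _
  refine ⟨Q, D, E, hQ, ⟨fun m => (hEs m).1 rfl, hE0, fun i => hex i (hr _)⟩, fun i hi => ?_⟩
  have := hsub i hi
  infer_instance

/-- There is an exact sequence `0 → C ⊗ P_n → ⋯ → C ⊗ P_0 → M → 0` with each `P_i`
projective iff `Hom_R(C,M)` has projective dimension at most `n`; that is,
`P_C-pd(M) = pd_R(Hom_R(C,M))`. -/
theorem boundedExactCRes_iff_homProjDimLE
    (R : Type) [CommRing R] (C : Type) [AddCommGroup C] [Module R C]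
    (M : Type) [AddCommGroup M] [Module R M] (hC : IsSemidualizing R C) (n : ℕ) :
    HasBoundedExactCRes R C M n ↔ HasProjDimLE R (C →ₗ[R] M) n := by
  obtain ⟨⟨F, d, ε, hF, hproj, hε, h0, hs⟩, hb, hext⟩ := hC
  have : Module.Finite R C := have := hF 0; Module.Finite.of_surjective ε hε
  have hacyc : SdzAcyc F d C := fun i g hg =>
    sdz_hom_exact_of_ext R C C F d ε hproj hε h0 hs i (hext (i + 1) (by omega)) g hg
  exact ⟨sdz_forward hF hproj hε h0 hs hb hacyc M n, sdz_backward hF hproj hε h0 hs hb hacyc M n⟩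

end
end

section
/- Let R be a commutative ring, C a semidualizing R-module, M an R-module, and n a nonnegative integer. Then M has injective dimension at most n if and only if there exists an exact sequence 0 → Hom_R(C,M) → Hom_R(C,I^0) → ⋯ → Hom_R(C,I^n) → 0 with each I^j an injective R-module. Consequently id_R(M) equals the I_C-injective dimension of Hom_R(C,M). -/
open TensorProduct CategoryTheory

noncomputable section

section ExtPart
open CategoryTheory.Limits

variable {R : Type} [CommRing R] {C : Type} [AddCommGroup C] [Module R C]

theorem exists_factor_of_ext_aux (N : Type) [AddCommGroup N] [Module R N]
    (K : ChainComplex (ModuleCat.{0} R) ℕ) (ε : K.X 0 ⟶ ModuleCat.of R C)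
    (hP : ∀ n, Projective (K.X n)) (hε : Epi ε) (w : K.d 1 0 ≫ ε = 0)
    (h0 : (ShortComplex.mk _ _ w).Exact)
    (hd : ∀ n, K.ExactAt (n + 1))
    (n : ℕ) (hext : Subsingleton (extMod R C N (n + 1)))
    (f : K.X (n + 1) ⟶ ModuleCat.of R N) (hf : K.d (n + 2) (n + 1) ≫ f = 0) :
    ∃ g : K.X n ⟶ ModuleCat.of R N, K.d (n + 1) n ≫ g = f := by
  let π : K ⟶ (ChainComplex.single₀ (ModuleCat.{0} R)).obj (ModuleCat.of R C) :=
    (ChainComplex.toSingle₀Equiv K (ModuleCat.of R C)).symm ⟨ε, w⟩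
  have hq : QuasiIso π := ⟨fun n => by
    cases n with
    | zero =>
      rw [ChainComplex.quasiIsoAt₀_iff, ShortComplex.quasiIso_iff_of_zeros']
      · refine (ShortComplex.exact_and_epi_g_iff_of_iso ?_).2 ⟨h0, hε⟩
        refine ShortComplex.isoMk (Iso.refl _) (Iso.refl _) (Iso.refl _) ?_ ?_
        · exact (Category.id_comp (K.d 1 0)).trans (Category.comp_id (K.d 1 0)).symm
        · dsimp [π]
          simp
          rfl
      all_goals first | rfl | exact K.shape 0 0 (by simp)
    | succ n =>
      rw [quasiIsoAt_iff_exactAt']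
      · exact hd n
      · exact ChainComplex.exactAt_succ_single_obj _ _⟩
  let Q : ProjectiveResolution (ModuleCat.of R C) := { complex := K, π := π }
  have hz : IsZero ((K.linearYonedaObj R (ModuleCat.of R N)).homology (n + 1)) := by
    have := (Q.isoExt (R := R) (n + 1) (ModuleCat.of R N)).symm
    exact IsZero.of_iso (ModuleCat.isZero_of_subsingleton (extMod R C N (n+1))) this
  rw [← HomologicalComplex.exactAt_iff_isZero_homology,
    HomologicalComplex.exactAt_iff' _ n (n + 1) (n + 2) (by simp) (by simp),
    ShortComplex.moduleCat_exact_iff] at hz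
  obtain ⟨g, hg⟩ := hz f hf
  exact ⟨g, hg⟩

/-- Vanishing of `Ext` gives exactness of `Hom(P, C)` for a projective resolution `P`. -/
theorem exists_factor_of_ext (N : Type) [AddCommGroup N] [Module R N]
    (P : ℕ → ModuleCat.{0} R) (d : ∀ n, ↥(P (n + 1)) →ₗ[R] ↥(P n)) (ε : ↥(P 0) →ₗ[R] C)
    (hP : ∀ n, Module.Projective R ↥(P n)) (hε : Function.Surjective ε)
    (h0 : Function.Exact (d 0) ε) (hd : ∀ n, Function.Exact (d (n + 1)) (d n))
    (hext : ∀ i : ℕ, 1 ≤ i → Subsingleton (extMod R C N i))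
    (n : ℕ) (f : ↥(P (n + 1)) →ₗ[R] N) (hf : f ∘ₗ d (n + 1) = 0) :
    ∃ g : ↥(P n) →ₗ[R] N, g ∘ₗ d n = f := by
  have hdd : ∀ n, ModuleCat.ofHom (d (n+1)) ≫ ModuleCat.ofHom (d n) = 0 := by
    intro n
    ext x
    exact (hd n).apply_apply_eq_zero x
  have hKd : ∀ n, (ChainComplex.of P (fun n => ModuleCat.ofHom (d n)) hdd).d (n + 1) n =
      ModuleCat.ofHom (d n) := fun n =>
    ChainComplex.of_d P (fun n => ModuleCat.ofHom (d n)) n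
  have w : (ChainComplex.of P (fun n => ModuleCat.ofHom (d n)) hdd).d 1 0 ≫
      (ModuleCat.ofHom ε : P 0 ⟶ ModuleCat.of R C) = 0 := by
    refine (congrArg (fun t => t ≫ (ModuleCat.ofHom ε : P 0 ⟶ ModuleCat.of R C)) (hKd 0)).trans ?_
    ext x
    exact h0.apply_apply_eq_zero x
  obtain ⟨g, hg⟩ := exists_factor_of_ext_aux (C := C) N
    (ChainComplex.of P (fun n => ModuleCat.ofHom (d n)) hdd) (ModuleCat.ofHom ε)
    (fun n => (IsProjective.iff_projective (P n)).1 (hP n))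
    ((ModuleCat.epi_iff_surjective _).2 hε) w
    (by
      rw [ShortComplex.moduleCat_exact_iff]
      intro x hx
      obtain ⟨y, hy⟩ := (h0 x).1 hx
      refine ⟨y, ?_⟩
      refine Eq.trans ?_ hy
      exact congrArg (fun t : P 1 ⟶ P 0 => t.hom y) (hKd 0))
    (by
      intro n
      rw [HomologicalComplex.exactAt_iff' _ (n + 2) (n + 1) n (by simp) (by simp)]
      rw [ShortComplex.moduleCat_exact_iff]
      intro x hx
      obtain ⟨y, hy⟩ := (hd n x).1 (by
        refine Eq.trans ?_ hx
        exact congrArg (fun t : P (n+1) ⟶ P n => t.hom x) (hKd n).symm)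
      refine ⟨y, ?_⟩
      refine Eq.trans ?_ hy
      exact congrArg (fun t : P (n+2) ⟶ P (n+1) => t.hom y) (hKd (n+1)))
    n (hext _ (by omega)) (ModuleCat.ofHom f) (by
      refine (congrArg (fun t : P (n+2) ⟶ P (n+1) => t ≫ (ModuleCat.ofHom f : P (n+1) ⟶ ModuleCat.of R N))
        (hKd (n+1))).trans ?_
      rw [← ModuleCat.ofHom_comp, hf]
      rfl)
  refine ⟨g.hom, ?_⟩
  have h2 := (congrArg (fun t : P (n+1) ⟶ P n => t ≫ (g : P n ⟶ ModuleCat.of R N))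
        (hKd n)).symm.trans hg
  exact congrArg (fun t => t.hom) h2

end ExtPart
section Faithful

variable {R : Type} [CommRing R]

/-- A multilinear map vanishing on a submodule `L` (in all arguments) vanishes, provided
all linear maps into the target vanishing on `L` are zero. -/
theorem multilinear_eq_zero {V N : Type} [AddCommGroup V] [Module R V]
    [AddCommGroup N] [Module R N] (L : Submodule R V)
    (h : ∀ φ : V →ₗ[R] N, (∀ l ∈ L, φ l = 0) → φ = 0) :
    ∀ (m : ℕ) (f : MultilinearMap R (fun _ : Fin m => V) N),
      (∀ v : Fin m → V, (∀ i, v i ∈ L) → f v = 0) → f = 0 := by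
  intro m
  induction m with
  | zero =>
    intro f hf
    ext v
    exact hf v (fun i => i.elim0)
  | succ m ih =>
    intro f hf
    have h1 : ∀ l ∈ L, f.curryLeft l = 0 := by
      intro l hl
      apply ih
      intro v hv
      rw [MultilinearMap.curryLeft_apply]
      apply hf
      intro i
      refine Fin.cases ?_ ?_ i
      · simpa using hl
      · intro j
        simpa using hv j
    ext v
    have h2 := h { toFun := fun x => f.curryLeft x (Fin.tail v)
                   map_add' := fun x y => by rw [map_add]; rfl
                   map_smul' := fun r x => by rw [map_smul]; rfl } (by
      intro l hl
      change f.curryLeft l (Fin.tail v) = 0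
      rw [h1 l hl]
      rfl)
    have h3 : f.curryLeft (v 0) (Fin.tail v) = 0 := LinearMap.congr_fun h2 (v 0)
    rw [MultilinearMap.curryLeft_apply, Fin.cons_self_tail] at h3
    exact h3

theorem exists_factor_of_surjective {A B D : Type} [AddCommGroup A] [Module R A]
    [AddCommGroup B] [Module R B] [AddCommGroup D] [Module R D]
    (π : A →ₗ[R] B) (hπ : Function.Surjective π) (φ : A →ₗ[R] D)
    (h : ∀ x, π x = 0 → φ x = 0) : ∃ ψ : B →ₗ[R] D, ψ ∘ₗ π = φ := by
  refine ⟨(LinearMap.ker π).liftQ φ (fun x hx => h x hx) ∘ₗ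
    (π.quotKerEquivOfSurjective hπ).symm.toLinearMap, ?_⟩
  ext x
  have : (π.quotKerEquivOfSurjective hπ).symm (π x) = (LinearMap.ker π).mkQ x := by
    rw [LinearEquiv.symm_apply_eq]
    rfl
  simp only [LinearMap.comp_apply, LinearEquiv.coe_coe, this]
  rfl

theorem exists_factor_of_injective {A B D : Type} [AddCommGroup A] [Module R A]
    [AddCommGroup B] [Module R B] [AddCommGroup D] [Module R D]
    (j : A →ₗ[R] B) (hj : Function.Injective j) (φ : D →ₗ[R] B)
    (h : ∀ x, ∃ a, j a = φ x) : ∃ ψ : D →ₗ[R] A, j ∘ₗ ψ = φ := by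
  refine ⟨(LinearEquiv.ofInjective j hj).symm.toLinearMap ∘ₗ
    φ.codRestrict (LinearMap.range j) (fun x => h x), ?_⟩
  ext x
  have := (LinearEquiv.ofInjective j hj).apply_symm_apply
    (φ.codRestrict (LinearMap.range j) (fun x => h x) x)
  exact congrArg Subtype.val this

theorem exists_extend_of_exact {A B D I : Type} [AddCommGroup A] [Module R A]
    [AddCommGroup B] [Module R B] [AddCommGroup D] [Module R D] [AddCommGroup I] [Module R I]
    (hI : Module.Injective R I) (a : A →ₗ[R] B) (b : B →ₗ[R] D)
    (hab : ∀ x, b x = 0 → ∃ y, a y = x)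
    (φ : B →ₗ[R] I) (hφ : φ ∘ₗ a = 0) : ∃ ψ : D →ₗ[R] I, ψ ∘ₗ b = φ := by
  obtain ⟨χ, hχ⟩ := exists_factor_of_surjective b.rangeRestrict b.surjective_rangeRestrict φ
    (by
      intro x hx
      obtain ⟨y, rfl⟩ := hab x (congrArg Subtype.val hx)
      exact LinearMap.congr_fun hφ y)
  obtain ⟨ψ, hψ⟩ := hI.out (LinearMap.range b).subtype (Submodule.subtype_injective _) χ
  refine ⟨ψ, ?_⟩
  ext x
  rw [← hχ]
  exact hψ (b.rangeRestrict x)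

theorem subsingleton_of_hom {C N : Type} [AddCommGroup C] [Module R C] [AddCommGroup N]
    [Module R N] [Module.Finite R C]
    (hfaith : ∀ r : R, (∀ c : C, r • c = 0) → r = 0)
    (h : ∀ φ : C →ₗ[R] N, φ = 0) : Subsingleton N := by
  obtain ⟨n, π, hπ⟩ := Module.Finite.exists_fin' R C
  have key := multilinear_eq_zero (N := N) (LinearMap.ker π) (by
    intro φ hφ
    obtain ⟨ψ, hψ⟩ : ∃ ψ : C →ₗ[R] N, ψ ∘ₗ π = φ := by
      exact exists_factor_of_surjective π hπ φ fun x hx => hφ x hx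
    rw [← hψ, h ψ, LinearMap.zero_comp]) n
  refine subsingleton_of_forall_eq 0 fun y => ?_
  have := key ((LinearMap.toSpanSingleton R N y).compMultilinearMap
    (Matrix.detRowAlternating (R := R) (n := Fin n)).toMultilinearMap) (by
    intro v hv
    have hdet : Matrix.det (Matrix.of v) = 0 := by
      apply hfaith
      intro c
      obtain ⟨x, rfl⟩ := hπ c
      rw [← map_smul]
      have h1 : Matrix.det (Matrix.of v) • x =
          Matrix.vecMul (Matrix.vecMul x (Matrix.of v).adjugate) (Matrix.of v) := by
        rw [Matrix.vecMul_vecMul, Matrix.adjugate_mul, Matrix.vecMul_smul, Matrix.vecMul_one]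
      rw [h1, Matrix.vecMul_eq_sum, map_sum]
      refine Finset.sum_eq_zero fun i _ => ?_
      rw [map_smul]
      have : π (Matrix.of v i) = 0 := hv i
      rw [this, smul_zero]
    change Matrix.det (Matrix.of v) • y = 0
    rw [hdet, zero_smul])
  have h2 := congrArg (fun f => f (1 : Matrix (Fin n) (Fin n) R)) this
  have h3 : Matrix.det (1 : Matrix (Fin n) (Fin n) R) • y = 0 := h2
  rwa [Matrix.det_one, one_smul] at h3

end Faithful
section Core

variable {R : Type} [CommRing R]

theorem tor_chase {X1 X2 Y0 Y1 Y2 Y3 Z1 Z2 Z3 : Type}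
    [AddCommGroup X1] [AddCommGroup X2] [AddCommGroup Y0] [AddCommGroup Y1]
    [AddCommGroup Y2] [AddCommGroup Y3] [AddCommGroup Z1] [AddCommGroup Z2] [AddCommGroup Z3]
    [Module R X1] [Module R X2] [Module R Y0] [Module R Y1]
    [Module R Y2] [Module R Y3] [Module R Z1] [Module R Z2] [Module R Z3]
    (dX : X2 →ₗ[R] X1) (dY2 : Y3 →ₗ[R] Y2) (dY1 : Y2 →ₗ[R] Y1) (dY0 : Y1 →ₗ[R] Y0)
    (dZ2 : Z3 →ₗ[R] Z2) (dZ1 : Z2 →ₗ[R] Z1)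
    (i1 : X1 →ₗ[R] Y1) (i2 : X2 →ₗ[R] Y2) (p1 : Y1 →ₗ[R] Z1) (p2 : Y2 →ₗ[R] Z2)
    (p3 : Y3 →ₗ[R] Z3)
    (hi1 : Function.Injective i1) (hp3 : Function.Surjective p3)
    (h2 : Function.Exact i2 p2) (h1 : ∀ x, p1 (i1 x) = 0)
    (hY1 : Function.Exact dY1 dY0) (hY2 : ∀ y, dY1 (dY2 y) = 0) (hZ : Function.Exact dZ2 dZ1)
    (ci : ∀ x, dY1 (i2 x) = i1 (dX x)) (cp1 : ∀ y, dZ1 (p2 y) = p1 (dY1 y))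
    (cp2 : ∀ y, dZ2 (p3 y) = p2 (dY2 y))
    (x : X1) (hx : dY0 (i1 x) = 0) : ∃ x', dX x' = x := by
  obtain ⟨y, hy⟩ := (hY1 _).1 hx
  obtain ⟨z, hz⟩ := (hZ (p2 y)).1 (by rw [cp1, hy, h1])
  obtain ⟨y', rfl⟩ := hp3 z
  obtain ⟨x', hx'⟩ := (h2 (y - dY2 y')).1 (by rw [map_sub, ← cp2, hz, sub_self])
  refine ⟨x', hi1 ?_⟩
  rw [← ci, hx', map_sub, hY2, sub_zero, hy]

/-- Working data extracted from `IsSemidualizing`. -/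
structure SDData (R : Type) [CommRing R] (C : Type) [AddCommGroup C] [Module R C] where
  P : ℕ → ModuleCat.{0} R
  d : ∀ n, ↥(P (n + 1)) →ₗ[R] ↥(P n)
  ε : ↥(P 0) →ₗ[R] C
  fin : ∀ n, Module.Finite R ↥(P n)
  proj : ∀ n, Module.Projective R ↥(P n)
  surj : Function.Surjective ε
  ex0 : Function.Exact (d 0) ε
  ex : ∀ n, Function.Exact (d (n + 1)) (d n)
  bij : Function.Bijective (fun r : R => (r • LinearMap.id : C →ₗ[R] C))
  fact : ∀ (n : ℕ) (f : ↥(P (n + 1)) →ₗ[R] C), f ∘ₗ d (n + 1) = 0 →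
    ∃ g : ↥(P n) →ₗ[R] C, g ∘ₗ d n = f

theorem IsSemidualizing.data {C : Type} [AddCommGroup C] [Module R C]
    (h : IsSemidualizing R C) : Nonempty (SDData R C) := by
  obtain ⟨⟨P, d, ε, h1, h2, h3, h4, h5⟩, hb, he⟩ := h
  exact ⟨⟨P, d, ε, h1, h2, h3, h4, h5, hb,
    exists_factor_of_ext C P d ε h2 h3 h4 h5 he⟩⟩

variable {C : Type} [AddCommGroup C] [Module R C] (D : SDData R C)

namespace SDData

theorem finite (D : SDData R C) : Module.Finite R C := by
  have := D.fin 0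
  exact Module.Finite.of_surjective D.ε D.surj

theorem faithful (D : SDData R C) (r : R) (h : ∀ c : C, r • c = 0) : r = 0 := by
  apply D.bij.1
  ext c
  simp [h]

theorem subsingleton_of_hom (D : SDData R C) {N : Type} [AddCommGroup N] [Module R N]
    (h : ∀ φ : C →ₗ[R] N, φ = 0) : Subsingleton N := by
  have := D.finite
  exact _root_.subsingleton_of_hom D.faithful h

theorem subsingleton_of_tensor (D : SDData R C) {K : Type} [AddCommGroup K] [Module R K]
    (h : Subsingleton (C ⊗[R] K)) : Subsingleton K := by
  have h1 : Subsingleton (K →ₗ[R] K) := by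
    apply D.subsingleton_of_hom
    intro φ
    ext c k
    have : TensorProduct.lift φ (c ⊗ₜ k) = TensorProduct.lift φ 0 := by
      rw [Subsingleton.elim (c ⊗ₜ[R] k) 0]
    simpa using this
  refine subsingleton_of_forall_eq 0 fun k => ?_
  exact LinearMap.congr_fun (Subsingleton.elim (LinearMap.id : K →ₗ[R] K) 0) k

theorem surjective_of_lTensor (D : SDData R C) {X Y : Type} [AddCommGroup X] [Module R X]
    [AddCommGroup Y] [Module R Y] (f : X →ₗ[R] Y)
    (h : Function.Surjective (f.lTensor C)) : Function.Surjective f := by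
  have h1 : Subsingleton (C ⊗[R] (Y ⧸ LinearMap.range f)) := by
    refine subsingleton_of_forall_eq 0 fun t => ?_
    obtain ⟨s, rfl⟩ := LinearMap.lTensor_surjective C (LinearMap.range f).mkQ_surjective t
    obtain ⟨u, rfl⟩ := h s
    rw [← LinearMap.comp_apply, ← LinearMap.lTensor_comp, LinearMap.range_mkQ_comp]
    simp
  have h2 := D.subsingleton_of_tensor h1
  rw [← LinearMap.range_eq_top]
  exact Submodule.Quotient.subsingleton_iff.1 h2

/-- `Tor_i(C, X) = 0` for `i ≥ 1`. -/
def TA (D : SDData R C) (X : Type) [AddCommGroup X] [Module R X] : Prop :=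
  ∀ n, Function.Exact ((D.d (n + 1)).rTensor X) ((D.d n).rTensor X)

theorem TA.of_subsingleton (X : Type) [AddCommGroup X] [Module R X] [Subsingleton X] :
    D.TA X := by
  intro n x
  have : ∀ (A : Type) [AddCommGroup A] [Module R A], Subsingleton (A ⊗[R] X) := by
    intro A _ _
    infer_instance
  have h1 := this (D.P n)
  have h2 := this (D.P (n+1))
  exact ⟨fun _ => ⟨0, Subsingleton.elim _ _⟩, fun _ => Subsingleton.elim _ _⟩

theorem TA.of_ses {X Y Z : Type} [AddCommGroup X] [Module R X] [AddCommGroup Y] [Module R Y]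
    [AddCommGroup Z] [Module R Z] (f : X →ₗ[R] Y) (g : Y →ₗ[R] Z)
    (hf : Function.Injective f) (hfg : Function.Exact f g) (hg : Function.Surjective g)
    (hY : D.TA Y) (hZ : D.TA Z) : D.TA X ∧ Function.Injective (f.lTensor C) := by
  have hi : ∀ n, Function.Injective (f.lTensor (D.P n)) := by
    intro n
    have := D.proj n
    exact Module.Flat.lTensor_preserves_injective_linearMap f hf
  have he : ∀ n, Function.Exact (f.lTensor (D.P n)) (g.lTensor (D.P n)) :=
    fun n => lTensor_exact _ hfg hg
  have hs : ∀ n, Function.Surjective (g.lTensor (D.P n)) :=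
    fun n => LinearMap.lTensor_surjective _ hg
  have comm : ∀ {A B U V : Type} [AddCommGroup A] [Module R A] [AddCommGroup B] [Module R B]
      [AddCommGroup U] [Module R U] [AddCommGroup V] [Module R V] (a : A →ₗ[R] B)
      (u : U →ₗ[R] V) (t : A ⊗[R] U),
      a.rTensor V (u.lTensor A t) = u.lTensor B (a.rTensor U t) := by
    intro A B U V _ _ _ _ _ _ _ _ a u t
    rw [← LinearMap.comp_apply, ← LinearMap.comp_apply, LinearMap.rTensor_comp_lTensor,
      LinearMap.lTensor_comp_rTensor]
  constructor
  · intro n x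
    constructor
    · intro hx
      exact tor_chase ((D.d (n+1)).rTensor X) ((D.d (n+2)).rTensor Y) ((D.d (n+1)).rTensor Y)
        ((D.d n).rTensor Y) ((D.d (n+2)).rTensor Z) ((D.d (n+1)).rTensor Z)
        (f.lTensor _) (f.lTensor _) (g.lTensor _) (g.lTensor _) (g.lTensor _)
        (hi _) (hs _) (he _) (he _).apply_apply_eq_zero (hY n)
        (hY (n+1)).apply_apply_eq_zero (hZ (n+1)) (comm _ _) (comm _ _) (comm _ _) x
        (by rw [comm, hx, map_zero])
    · rintro ⟨y, rfl⟩
      rw [← LinearMap.comp_apply, ← LinearMap.rTensor_comp, (D.ex n).linearMap_comp_eq_zero]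
      simp
  · rw [injective_iff_map_eq_zero]
    intro c hc
    obtain ⟨x, rfl⟩ := LinearMap.rTensor_surjective X D.surj c
    obtain ⟨x', rfl⟩ := tor_chase ((D.d 0).rTensor X) ((D.d 1).rTensor Y) ((D.d 0).rTensor Y)
        (D.ε.rTensor Y) ((D.d 1).rTensor Z) ((D.d 0).rTensor Z)
        (f.lTensor _) (f.lTensor _) (g.lTensor _) (g.lTensor _) (g.lTensor _)
        (hi _) (hs _) (he _) (he _).apply_apply_eq_zero (rTensor_exact Y D.ex0 D.surj)
        (hY 0).apply_apply_eq_zero (hZ 0) (comm _ _) (comm _ _) (comm _ _) x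
        (by rw [comm, hc])
    rw [← LinearMap.comp_apply, ← LinearMap.rTensor_comp, D.ex0.linearMap_comp_eq_zero]
    simp

/-- `P ⊗ Hom(C, I) → Hom(Hom(P, C), I)`. -/
def theta (R : Type) [CommRing R] (C P I : Type) [AddCommGroup C] [Module R C]
    [AddCommGroup P] [Module R P] [AddCommGroup I] [Module R I] :
    (P ⊗[R] (C →ₗ[R] I)) →ₗ[R] ((P →ₗ[R] C) →ₗ[R] I) :=
  TensorProduct.lift (LinearMap.mk₂ R (fun p f => f ∘ₗ (LinearMap.applyₗ p))
    (fun _ _ _ => by ext; simp) (fun _ _ _ => by ext; simp)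
    (fun _ _ _ => by ext; simp) (fun _ _ _ => by ext; simp))

@[simp]
theorem theta_tmul {P I : Type} [AddCommGroup P] [Module R P] [AddCommGroup I] [Module R I]
    (p : P) (f : C →ₗ[R] I) (g : P →ₗ[R] C) : theta R C P I (p ⊗ₜ f) g = f (g p) := rfl

theorem theta_nat {P P' I : Type} [AddCommGroup P] [Module R P] [AddCommGroup P'] [Module R P']
    [AddCommGroup I] [Module R I] (a : P' →ₗ[R] P) (t : P' ⊗[R] (C →ₗ[R] I)) :
    theta R C P I (a.rTensor _ t) = theta R C P' I t ∘ₗ LinearMap.lcomp R C a := by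
  induction t with
  | zero => simp
  | add x y hx hy => rw [map_add, map_add, hx, hy, map_add, LinearMap.add_comp]
  | tmul p f => rfl

theorem theta_bijective (P I : Type) [AddCommGroup P] [Module R P] [AddCommGroup I] [Module R I]
    [Module.Finite R P] [Module.Projective R P] : Function.Bijective (theta R C P I) := by
  obtain ⟨n, a, b, -, -, hab⟩ := Module.Finite.exists_comp_eq_id_of_projective R P
  have hdual : ∀ p : P, ∑ i, (b p i) • a (Pi.single i 1) = p := by
    intro p
    have h1 : a (b p) = p := LinearMap.congr_fun hab p
    conv_rhs => rw [← h1, pi_eq_sum_univ' (b p), map_sum]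
    refine Finset.sum_congr rfl fun i _ => ?_
    rw [map_smul]
  let inv : ((P →ₗ[R] C) →ₗ[R] I) →ₗ[R] (P ⊗[R] (C →ₗ[R] I)) :=
    ∑ i, (TensorProduct.mk R P (C →ₗ[R] I) (a (Pi.single i 1))) ∘ₗ
      (LinearMap.lcomp R I (LinearMap.smulRightₗ (LinearMap.proj i ∘ₗ b)))
  have hinv : ∀ φ, inv φ = ∑ i, a (Pi.single i 1) ⊗ₜ
      (φ ∘ₗ (LinearMap.smulRightₗ (LinearMap.proj i ∘ₗ b))) := by
    intro φ
    simp only [inv, LinearMap.sum_apply]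
    rfl
  refine Function.bijective_iff_has_inverse.2 ⟨inv, ?_, ?_⟩
  · intro t
    induction t with
    | zero => simp
    | add x y hx hy => rw [map_add, map_add, hx, hy]
    | tmul p f =>
      rw [hinv]
      have : ∀ i, theta R C P I (p ⊗ₜ f) ∘ₗ (LinearMap.smulRightₗ (LinearMap.proj i ∘ₗ b)) =
          (b p i) • f := by
        intro i
        ext c
        simp
      simp only [this]
      conv_rhs => rw [← hdual p, TensorProduct.sum_tmul]
      simp only [TensorProduct.tmul_smul, TensorProduct.smul_tmul']
  · intro φ
    rw [hinv]
    ext g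
    rw [map_sum, LinearMap.sum_apply]
    simp only [theta_tmul, LinearMap.comp_apply]
    rw [← map_sum]
    congr 1
    ext p
    conv_rhs => rw [← hdual p, map_sum]
    simp

theorem eval_eq_theta {I : Type} [AddCommGroup I] [Module R I] (t : C ⊗[R] (C →ₗ[R] I)) :
    evalNu R C I t = theta R C C I t LinearMap.id := by
  induction t with
  | zero => simp
  | add x y hx hy => rw [map_add, map_add, hx, hy, LinearMap.add_apply]
  | tmul p f => rfl

theorem TA_hom (I : Type) [AddCommGroup I] [Module R I] (hI : Module.Injective R I) :
    D.TA (C →ₗ[R] I) := by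
  intro n x
  have := D.fin
  have := D.proj
  constructor
  · intro hx
    obtain ⟨ψ, hψ⟩ := exists_extend_of_exact hI (LinearMap.lcomp R C (D.d n))
      (LinearMap.lcomp R C (D.d (n+1))) (fun f hf => D.fact n f hf) (theta R C _ I x)
      (by rw [← theta_nat, hx, map_zero])
    obtain ⟨y, rfl⟩ := (theta_bijective _ I).2 ψ
    refine ⟨y, (theta_bijective (C := C) _ I).1 ?_⟩
    rw [theta_nat, hψ]
  · rintro ⟨y, rfl⟩
    rw [← LinearMap.comp_apply, ← LinearMap.rTensor_comp, (D.ex n).linearMap_comp_eq_zero]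
    simp

theorem nu_bijective (D : SDData R C) (I : Type) [AddCommGroup I] [Module R I] (hI : Module.Injective R I) :
    Function.Bijective (evalNu R C I) := by
  have := D.fin
  have := D.proj
  constructor
  · rw [injective_iff_map_eq_zero]
    intro t ht
    rw [eval_eq_theta] at ht
    have h0 : theta R C C I t = 0 := by
      ext g
      obtain ⟨r, rfl⟩ := D.bij.2 g
      simp [ht]
    obtain ⟨x, rfl⟩ := LinearMap.rTensor_surjective _ D.surj t
    rw [theta_nat] at h0
    obtain ⟨ψ, hψ⟩ := exists_extend_of_exact hI (LinearMap.lcomp R C D.ε)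
      (LinearMap.lcomp R C (D.d 0)) (fun f hf =>
        exists_factor_of_surjective D.ε D.surj f (fun p hp => by
          obtain ⟨q, rfl⟩ := (D.ex0 p).1 hp
          exact LinearMap.congr_fun hf q)) (theta R C _ I x) h0
    obtain ⟨y, rfl⟩ := (theta_bijective _ I).2 ψ
    have hy : (D.d 0).rTensor _ y = x := by
      apply (theta_bijective (C := C) _ I).1
      rw [theta_nat, hψ]
    rw [← hy, ← LinearMap.comp_apply, ← LinearMap.rTensor_comp, D.ex0.linearMap_comp_eq_zero]
    simp
  · intro i
    let e : R ≃ₗ[R] (C →ₗ[R] C) := LinearEquiv.ofBijective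
      (LinearMap.toSpanSingleton R (C →ₗ[R] C) LinearMap.id) D.bij
    obtain ⟨φ, hφ⟩ := hI.out (LinearMap.lcomp R C D.ε) (by
      intro f g hfg
      ext c
      obtain ⟨p, rfl⟩ := D.surj c
      exact LinearMap.congr_fun hfg p)
      ((LinearMap.toSpanSingleton R I i) ∘ₗ e.symm.toLinearMap)
    obtain ⟨x, rfl⟩ := (theta_bijective _ I).2 φ
    refine ⟨D.ε.rTensor _ x, ?_⟩
    rw [eval_eq_theta, theta_nat, LinearMap.comp_apply, hφ]
    have : e.symm LinearMap.id = 1 := by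
      rw [LinearEquiv.symm_apply_eq]
      exact (one_smul R _).symm
    simp [this]

/-- The part of the Bass class conditions that is used below. -/
def BC (D : SDData R C) (N : Type) [AddCommGroup N] [Module R N] : Prop :=
  D.TA (C →ₗ[R] N) ∧ Function.Bijective (evalNu R C N)

theorem nu_nat {M N : Type} [AddCommGroup M] [Module R M] [AddCommGroup N] [Module R N]
    (g : M →ₗ[R] N) (t : C ⊗[R] (C →ₗ[R] M)) :
    evalNu R C N ((LinearMap.compRight R g : (C →ₗ[R] M) →ₗ[R] (C →ₗ[R] N)).lTensor C t) =
      g (evalNu R C M t) := by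
  induction t with
  | zero => simp
  | add x y hx hy => simp only [map_add, hx, hy]
  | tmul p f => rfl

theorem BC.of_subsingleton (N : Type) [AddCommGroup N] [Module R N] [Subsingleton N] :
    D.BC N := by
  have h : Subsingleton (C ⊗[R] (C →ₗ[R] N)) := inferInstance
  exact ⟨TA.of_subsingleton D _, fun _ _ _ => Subsingleton.elim _ _,
    fun _ => ⟨0, Subsingleton.elim _ _⟩⟩

theorem BC.of_ses {M I N : Type} [AddCommGroup M] [Module R M] [AddCommGroup I] [Module R I]
    [AddCommGroup N] [Module R N] (f : M →ₗ[R] I) (g : I →ₗ[R] N)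
    (hf : Function.Injective f) (hfg : Function.Exact f g) (hg : Function.Surjective g)
    (hI : D.BC I) (hN : D.BC N) :
    D.BC M ∧ Function.Surjective (LinearMap.compRight R g : (C →ₗ[R] I) →ₗ[R] (C →ₗ[R] N)) ∧
      Function.Injective (LinearMap.compRight R f : (C →ₗ[R] M) →ₗ[R] (C →ₗ[R] I)) ∧
      Function.Exact (LinearMap.compRight R f : (C →ₗ[R] M) →ₗ[R] (C →ₗ[R] I))
        (LinearMap.compRight R g : (C →ₗ[R] I) →ₗ[R] (C →ₗ[R] N)) := by
  have hs : Function.Surjective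
      (LinearMap.compRight R g : (C →ₗ[R] I) →ₗ[R] (C →ₗ[R] N)) := by
    apply D.surjective_of_lTensor
    intro s
    obtain ⟨i, hi⟩ := hg (evalNu R C N s)
    obtain ⟨t, rfl⟩ := hI.2.2 i
    exact ⟨t, hN.2.1 (by rw [nu_nat, hi])⟩
  have hi : Function.Injective
      (LinearMap.compRight R f : (C →ₗ[R] M) →ₗ[R] (C →ₗ[R] I)) := by
    intro a b hab
    ext c
    exact hf (LinearMap.congr_fun hab c)
  have he : Function.Exact (LinearMap.compRight R f : (C →ₗ[R] M) →ₗ[R] (C →ₗ[R] I))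
        (LinearMap.compRight R g : (C →ₗ[R] I) →ₗ[R] (C →ₗ[R] N)) := by
    intro a
    constructor
    · intro ha
      obtain ⟨b, hb⟩ := exists_factor_of_injective f hf a
        (fun x => (hfg _).1 (LinearMap.congr_fun ha x))
      exact ⟨b, hb⟩
    · rintro ⟨b, rfl⟩
      ext c
      exact hfg.apply_apply_eq_zero (b c)
  obtain ⟨hT, hinj⟩ := TA.of_ses D _ _ hi he hs hI.1 hN.1
  refine ⟨⟨hT, ?_, ?_⟩, hs, hi, he⟩
  · intro a b hab
    apply hinj
    apply hI.2.1
    rw [nu_nat, nu_nat, hab]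
  · intro m
    obtain ⟨t, ht⟩ := hI.2.2 (f m)
    obtain ⟨s, rfl⟩ := ((lTensor_exact C he hs) t).1 (hN.2.1 (by
      rw [nu_nat, ht, hfg.apply_apply_eq_zero, map_zero]))
    refine ⟨s, hf ?_⟩
    rw [← nu_nat, ht]

/-- `M` has a coresolution `0 → M → F I⁰ → ⋯ → F Iⁿ⁻¹ → 0` with `n` terms, with the `Iʲ`
injective. -/
def Res (F : ModuleCat.{0} R → ModuleCat.{0} R) : ℕ → ModuleCat.{0} R → Prop
  | 0, M => Subsingleton M
  | n + 1, M => ∃ (I N : ModuleCat.{0} R) (f : M →ₗ[R] F I) (g : F I →ₗ[R] N),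
      Module.Injective R I ∧ Function.Injective f ∧ Function.Exact f g ∧
      Function.Surjective g ∧ Res F n N

theorem Res.of_equiv (F : ModuleCat.{0} R → ModuleCat.{0} R) (n : ℕ) (M M' : ModuleCat.{0} R)
    (e : M ≃ₗ[R] M') (h : Res F n M) : Res F n M' := by
  cases n with
  | zero =>
    have : Subsingleton M := h
    exact e.symm.injective.subsingleton
  | succ n =>
    obtain ⟨I, N, f, g, hI, hf, hfg, hg, hN⟩ := h
    refine ⟨I, N, f ∘ₗ e.symm.toLinearMap, g, hI, hf.comp e.symm.injective, ?_, hg, hN⟩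
    intro x
    rw [hfg x]
    constructor
    · rintro ⟨y, rfl⟩
      exact ⟨e y, by simp⟩
    · rintro ⟨y, rfl⟩
      exact ⟨e.symm y, rfl⟩

theorem Res.of_seq (F : ModuleCat.{0} R → ModuleCat.{0} R) (n : ℕ) :
    ∀ (M : ModuleCat.{0} R) (I : ℕ → ModuleCat.{0} R)
      (δ : ∀ j : ℕ, ↥(F (I j)) →ₗ[R] ↥(F (I (j + 1)))) (ι : M →ₗ[R] ↥(F (I 0)))
      (_ : ∀ j, Module.Injective R ↥(I j)) (_ : Function.Injective ι)
      (_ : Function.Exact ι (δ 0)) (_ : ∀ j, Function.Exact (δ j) (δ (j + 1)))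
      (_ : ∀ j, n ≤ j → Subsingleton ↥(F (I j))), Res F n M := by
  induction n with
  | zero =>
    intro M I δ ι hI hι h0 h1 hs
    have := hs 0 le_rfl
    exact hι.subsingleton
  | succ n ih =>
    intro M I δ ι hI hι h0 h1 hs
    refine ⟨I 0, ModuleCat.of R (LinearMap.range (δ 0)), ι, (δ 0).rangeRestrict, hI 0, hι, ?_,
      (δ 0).surjective_rangeRestrict, ?_⟩
    · intro x
      rw [← h0 x]
      exact Subtype.ext_iff
    · refine ih _ (fun j => I (j + 1)) (fun j => δ (j + 1)) (LinearMap.range (δ 0)).subtype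
        (fun j => hI _) (Submodule.subtype_injective _) ?_ (fun j => h1 (j + 1))
        (fun j hj => hs (j + 1) (by omega))
      intro x
      rw [h1 0 x]
      constructor
      · rintro ⟨y, rfl⟩
        exact ⟨⟨_, ⟨y, rfl⟩⟩, rfl⟩
      · rintro ⟨⟨_, ⟨y, rfl⟩⟩, rfl⟩
        exact ⟨y, rfl⟩

theorem Res.to_seq (F : ModuleCat.{0} R → ModuleCat.{0} R)
    (hF : Subsingleton (F (ModuleCat.of R PUnit))) (n : ℕ) :
    ∀ (M : ModuleCat.{0} R), Res F n M → ∃ (I : ℕ → ModuleCat.{0} R)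
      (δ : ∀ j : ℕ, ↥(F (I j)) →ₗ[R] ↥(F (I (j + 1)))) (ι : M →ₗ[R] ↥(F (I 0))),
      (∀ j, Module.Injective R ↥(I j)) ∧ Function.Injective ι ∧
      Function.Exact ι (δ 0) ∧ (∀ j, Function.Exact (δ j) (δ (j + 1))) ∧
      (∀ j, n ≤ j → Subsingleton ↥(F (I j))) := by
  induction n with
  | zero =>
    intro M h
    have : Subsingleton M := h
    refine ⟨fun _ => ModuleCat.of R PUnit, fun _ => 0, 0, ?_, fun _ _ _ => Subsingleton.elim _ _,
      ?_, ?_, fun _ _ => hF⟩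
    · intro j
      exact ⟨fun X Y _ _ _ _ f hf g => ⟨0, fun x => Subsingleton.elim _ _⟩⟩
    · intro x
      exact ⟨fun _ => ⟨0, Subsingleton.elim _ _⟩, fun _ => rfl⟩
    · intro j x
      exact ⟨fun _ => ⟨0, Subsingleton.elim _ _⟩, fun _ => rfl⟩
  | succ n ih =>
    rintro M ⟨I0, N, f, g, hI0, hf, hfg, hg, hN⟩
    obtain ⟨I, δ, ι, hI, hι, h0, h1, hs⟩ := ih N hN
    let I' : ℕ → ModuleCat.{0} R := fun j => Nat.casesOn j I0 I
    let δ' : ∀ j : ℕ, ↥(F (I' j)) →ₗ[R] ↥(F (I' (j + 1))) := fun j =>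
      match j with
      | 0 => ι ∘ₗ g
      | j + 1 => δ j
    refine ⟨I', δ', f, ?_, hf, ?_, ?_, ?_⟩
    · rintro (_ | j)
      · exact hI0
      · exact hI j
    · intro x
      rw [← hfg x]
      change ι (g x) = 0 ↔ _
      rw [map_eq_zero_iff ι hι]
    · rintro (_ | j)
      · intro x
        refine (h0 x).trans ?_
        constructor
        · rintro ⟨y, rfl⟩
          obtain ⟨z, rfl⟩ := hg y
          exact ⟨z, rfl⟩
        · rintro ⟨y, rfl⟩
          exact ⟨g y, rfl⟩
      · exact h1 j
    · rintro (_ | j) hj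
      · omega
      · exact hs j (by omega)

/-- The functor `Hom(C, -)` on objects. -/
def homF (R : Type) [CommRing R] (C : Type) [AddCommGroup C] [Module R C]
    (I : ModuleCat.{0} R) : ModuleCat.{0} R := ModuleCat.of R (C →ₗ[R] I)

theorem BC_of_res (n : ℕ) : ∀ M : ModuleCat.{0} R, Res id n M → D.BC M := by
  induction n with
  | zero =>
    intro M h
    have : Subsingleton M := h
    exact BC.of_subsingleton D M
  | succ n ih =>
    rintro M ⟨I, N, f, g, hI, hf, hfg, hg, hN⟩
    exact (BC.of_ses D f g hf hfg hg ⟨D.TA_hom I hI, D.nu_bijective I hI⟩ (ih N hN)).1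

theorem res_hom (D : SDData R C) (n : ℕ) : ∀ M : ModuleCat.{0} R, Res id n M →
    Res (homF R C) n (ModuleCat.of R (C →ₗ[R] M)) := by
  induction n with
  | zero =>
    intro M h
    have : Subsingleton M := h
    exact (inferInstance : Subsingleton (C →ₗ[R] M))
  | succ n ih =>
    rintro M ⟨I, N, f, g, hI, hf, hfg, hg, hN⟩
    obtain ⟨-, hs, hi, he⟩ := BC.of_ses D (I := I) f g hf hfg hg
      ⟨D.TA_hom I hI, D.nu_bijective I hI⟩ (D.BC_of_res n N hN)
    exact ⟨I, ModuleCat.of R (C →ₗ[R] N), LinearMap.compRight R f, LinearMap.compRight R g,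
      hI, hi, he, hs, ih N hN⟩

theorem nu_mu {M : Type} [AddCommGroup M] [Module R M] (h : C →ₗ[R] M) :
    evalNu R C M ∘ₗ muMap R C (C →ₗ[R] M) h = h := rfl

theorem mu_nat {X Y : Type} [AddCommGroup X] [Module R X] [AddCommGroup Y] [Module R Y]
    (f : X →ₗ[R] Y) (x : X) : f.lTensor C ∘ₗ muMap R C X x = muMap R C Y (f x) := rfl

theorem mu_hom_bijective (I : Type) [AddCommGroup I] [Module R I]
    (h : Function.Bijective (evalNu R C I)) : Function.Bijective (muMap R C (C →ₗ[R] I)) := by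
  constructor
  · intro a b hab
    rw [← nu_mu a, hab, nu_mu]
  · intro ψ
    refine ⟨evalNu R C I ∘ₗ ψ, ?_⟩
    ext c
    apply h.1
    exact LinearMap.congr_fun (nu_mu (evalNu R C I ∘ₗ ψ)) c

theorem tensor_step (D : SDData R C) {X N I : Type} [AddCommGroup X] [Module R X]
    [AddCommGroup N] [Module R N] [AddCommGroup I] [Module R I] (hI : Module.Injective R I)
    (f : X →ₗ[R] (C →ₗ[R] I)) (g : (C →ₗ[R] I) →ₗ[R] N) (hf : Function.Injective f)
    (hfg : Function.Exact f g) (hg : Function.Surjective g) (hTN : D.TA N)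
    (hμN : Function.Injective (muMap R C N)) :
    D.TA X ∧ Function.Bijective (muMap R C X) ∧
      ∃ (a : C ⊗[R] X →ₗ[R] I) (b : I →ₗ[R] C ⊗[R] N),
        Function.Injective a ∧ Function.Exact a b ∧ Function.Surjective b := by
  have hν := D.nu_bijective I hI
  obtain ⟨hT, hinj⟩ := TA.of_ses D (Y := C →ₗ[R] I) f g hf hfg hg (D.TA_hom I hI) hTN
  have hμ := mu_hom_bijective (C := C) I hν
  have hex : Function.Exact (f.lTensor C) (g.lTensor C) := lTensor_exact C hfg hg
  refine ⟨hT, ⟨?_, ?_⟩, ?_⟩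
  · intro a b hab
    apply hf
    apply hμ.1
    rw [← mu_nat, ← mu_nat, hab]
  · intro ψ
    obtain ⟨h, hh⟩ := hμ.2 (f.lTensor C ∘ₗ ψ)
    obtain ⟨x, rfl⟩ := (hfg h).1 (hμN (by
      rw [← mu_nat, hh, map_zero]
      ext c
      exact hex.apply_apply_eq_zero (ψ c)))
    refine ⟨x, ?_⟩
    rw [← mu_nat] at hh
    ext c
    exact hinj (LinearMap.congr_fun hh c)
  · let e := LinearEquiv.ofBijective _ hν
    refine ⟨e.toLinearMap ∘ₗ f.lTensor C,
      g.lTensor C ∘ₗ e.symm.toLinearMap, e.injective.comp hinj, ?_,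
      (LinearMap.lTensor_surjective C hg).comp e.symm.surjective⟩
    intro y
    refine (hex (e.symm y)).trans ?_
    constructor
    · rintro ⟨z, hz⟩
      refine ⟨z, ?_⟩
      change e (f.lTensor C z) = y
      rw [hz, e.apply_symm_apply]
    · rintro ⟨z, rfl⟩
      exact ⟨z, (e.symm_apply_apply _).symm⟩

theorem res_tensor (n : ℕ) : ∀ X : ModuleCat.{0} R, Res (homF R C) n X →
    D.TA X ∧ Function.Bijective (muMap R C X) ∧ Res id n (ModuleCat.of R (C ⊗[R] X)) := by
  induction n with
  | zero =>
    intro X h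
    have : Subsingleton X := h
    have h2 : Subsingleton (C ⊗[R] X) := inferInstance
    exact ⟨TA.of_subsingleton D X, ⟨fun _ _ _ => Subsingleton.elim _ _,
      fun _ => ⟨0, Subsingleton.elim _ _⟩⟩, h2⟩
  | succ n ih =>
    rintro X ⟨I, N, f, g, hI, hf, hfg, hg, hN⟩
    obtain ⟨hTN, hμN, hRN⟩ := ih N hN
    obtain ⟨hT, hμ, a, b, ha, hab, hb⟩ :=
      D.tensor_step (X := X) (N := N) (I := I) hI f g hf hfg hg hTN hμN.1
    exact ⟨hT, hμ, I, ModuleCat.of R (C ⊗[R] N), a, b, hI, ha, hab, hb, hRN⟩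

theorem nu_surjective_of (D : SDData R C) {M I Z : Type} [AddCommGroup M] [Module R M]
    [AddCommGroup I] [Module R I] [AddCommGroup Z] [Module R Z] (hI : Module.Injective R I)
    (a : C ⊗[R] (C →ₗ[R] M) →ₗ[R] I) (b : I →ₗ[R] Z) (ha : Function.Injective a)
    (hab : Function.Exact a b) (hb : Function.Surjective b) (hZ : D.BC Z)
    (hinj : Function.Injective (evalNu R C M)) : Function.Surjective (evalNu R C M) := by
  obtain ⟨-, hs, -, -⟩ := BC.of_ses D (I := I) a b ha hab hb
    ⟨D.TA_hom I hI, D.nu_bijective I hI⟩ hZ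
  obtain ⟨a', ha'⟩ := hI.out (evalNu R C M) hinj a
  obtain ⟨q, hq⟩ := exists_factor_of_surjective (LinearMap.range (evalNu R C M)).mkQ
    (Submodule.mkQ_surjective _) (b ∘ₗ a') (by
      intro x hx
      rw [Submodule.mkQ_apply, Submodule.Quotient.mk_eq_zero] at hx
      obtain ⟨t, rfl⟩ := hx
      rw [LinearMap.comp_apply, ha', hab.apply_apply_eq_zero])
  have hN : Subsingleton (M ⧸ LinearMap.range (evalNu R C M)) := by
    apply D.subsingleton_of_hom
    intro φ
    obtain ⟨k, hk⟩ := hs (q ∘ₗ φ)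
    obtain ⟨l, hl⟩ := exists_factor_of_injective
      ((LinearMap.range (evalNu R C M)).mkQ.prod a') (by
        rw [injective_iff_map_eq_zero]
        intro m hm
        have h1 : (LinearMap.range (evalNu R C M)).mkQ m = 0 := congrArg Prod.fst hm
        have h2 : a' m = 0 := congrArg Prod.snd hm
        rw [Submodule.mkQ_apply, Submodule.Quotient.mk_eq_zero] at h1
        obtain ⟨t, rfl⟩ := h1
        rw [ha'] at h2
        rw [(map_eq_zero_iff a ha).1 h2, map_zero]) (φ.prod k) (by
        intro c
        obtain ⟨m, hm⟩ := Submodule.mkQ_surjective _ (φ c)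
        have h1 : b (k c) = q (φ c) := LinearMap.congr_fun hk c
        have h2 : b (a' m) = q (φ c) := by
          rw [← hm]
          exact (LinearMap.congr_fun hq m).symm
        obtain ⟨t, ht⟩ := (hab (k c - a' m)).1 (by
          rw [map_sub]
          exact sub_eq_zero.2 (h1.trans h2.symm))
        refine ⟨m + evalNu R C M t, Prod.ext ?_ ?_⟩
        · change (LinearMap.range (evalNu R C M)).mkQ (m + evalNu R C M t) = φ c
          rw [map_add, hm]
          simp
        · change a' (m + evalNu R C M t) = k c
          rw [map_add, ha', ht]
          abel)
    ext c
    have h1 : (LinearMap.range (evalNu R C M)).mkQ (l c) = φ c :=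
      congrArg Prod.fst (LinearMap.congr_fun hl c)
    rw [← h1, LinearMap.zero_apply, Submodule.mkQ_apply, Submodule.Quotient.mk_eq_zero]
    exact ⟨c ⊗ₜ l, rfl⟩
  rw [← LinearMap.range_eq_top]
  exact Submodule.Quotient.subsingleton_iff.1 hN

theorem res_of_hom (D : SDData R C) (n : ℕ) (M : ModuleCat.{0} R)
    (h : Res (homF R C) n (ModuleCat.of R (C →ₗ[R] M))) : Res id n M := by
  obtain ⟨hT, hμ, hR⟩ := D.res_tensor n _ h
  change Function.Bijective (muMap R C (C →ₗ[R] M)) at hμ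
  cases n with
  | zero =>
    have : Subsingleton (C →ₗ[R] M) := h
    exact D.subsingleton_of_hom (N := M) fun φ => Subsingleton.elim _ _
  | succ n =>
    have hinj : Function.Injective (evalNu R C M) := by
      rw [← LinearMap.ker_eq_bot, ← Submodule.subsingleton_iff_eq_bot]
      apply D.subsingleton_of_hom
      intro φ
      obtain ⟨x, hx⟩ := hμ.2 ((LinearMap.ker (evalNu R C M)).subtype ∘ₗ φ)
      have hx0 : x = 0 := by
        rw [← nu_mu x, hx]
        ext c
        exact (φ c).2
      ext c
      have := LinearMap.congr_fun hx c
      rw [hx0, map_zero] at this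
      exact this.symm
    have hsurj : Function.Surjective (evalNu R C M) := by
      obtain ⟨I, Z, a, b, hI, ha, hab, hb, hZ⟩ := hR
      exact D.nu_surjective_of (M := M) (I := I) (Z := Z) hI a b ha hab hb
        (D.BC_of_res n Z hZ) hinj
    exact Res.of_equiv id (n + 1) _ M (LinearEquiv.ofBijective _ ⟨hinj, hsurj⟩) hR

end SDData

end Core

/-- `M` has injective dimension at most `n` iff there is an exact sequence
`0 → Hom_R(C,M) → Hom_R(C,I⁰) → ⋯ → Hom_R(C,Iⁿ) → 0` with each `I^j` injective;
that is, `id_R(M) = I_C-id(Hom_R(C,M))`. -/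
theorem injDimLE_iff_boundedExactCIRes_hom
    (R : Type) [CommRing R] (C : Type) [AddCommGroup C] [Module R C]
    (M : Type) [AddCommGroup M] [Module R M] (hC : IsSemidualizing R C) (n : ℕ) :
    HasInjDimLE R M n ↔
      ∃ (I : ℕ → ModuleCat.{0} R)
        (δ : ∀ j : ℕ, (C →ₗ[R] ↥(I j)) →ₗ[R] (C →ₗ[R] ↥(I (j + 1))))
        (ι : (C →ₗ[R] M) →ₗ[R] (C →ₗ[R] ↥(I 0))),
          (∀ j, Module.Injective R ↥(I j)) ∧ Function.Injective ι ∧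
          Function.Exact ι (δ 0) ∧ (∀ j, Function.Exact (δ j) (δ (j + 1))) ∧
          ∀ j, n < j → Subsingleton (C →ₗ[R] ↥(I j)) := by
  obtain ⟨D⟩ := hC.data
  constructor
  · rintro ⟨I, δ, ι, hI, hι, h0, h1, hs⟩
    have h := SDData.Res.of_seq id (n + 1) (ModuleCat.of R M) I δ ι hI hι h0 h1 hs
    exact SDData.Res.to_seq (SDData.homF R C)
      (inferInstanceAs (Subsingleton (C →ₗ[R] PUnit))) (n + 1) _ (D.res_hom (n + 1) _ h)
  · rintro ⟨I, δ, ι, hI, hι, h0, h1, hs⟩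
    have h := SDData.Res.of_seq (SDData.homF R C) (n + 1) (ModuleCat.of R (C →ₗ[R] M))
      I δ ι hI hι h0 h1 hs
    exact SDData.Res.to_seq id (inferInstanceAs (Subsingleton PUnit)) (n + 1)
      (ModuleCat.of R M) (D.res_of_hom (n + 1) (ModuleCat.of R M) h)

end
end
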